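/- Let d ≥ 1. Let ξ and η be equivariant random measures over the stationary ergodic flow system (Ω, 𝔉, ℙ, θ) with the same finite intensity, which are ℙ-a.s. mutually singular, and such that ℙ-a.s. ξ does not charge small sets. Then there exists a factor allocation balancing ξ and η. -/

import Mathlib

open MeasureTheory Filter Set

noncomputable section

/-- Euclidean space `ℝ^d`. -/
abbrev Eucl (d : ℕ) := EuclideanSpace ℝ (Fin d)

/-- The half-open unit cube `[0,1)^d`. -/
def unitCube (d : ℕ) : Set (Eucl d) := {x | ∀ i, x i ∈ Set.Ico (0 : ℝ) 1}

/-- `μ` does not charge small sets: it gives no mass to `(d-1)`-rectifiable sets,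
i.e. `μ (f '' ℝ^(d-1)) = 0` for every Lipschitz map `f : ℝ^(d-1) → ℝ^d`. -/
def DoesNotChargeSmallSets (d : ℕ) (μ : Measure (Eucl d)) : Prop :=
  ∀ (f : Eucl (d - 1) → Eucl d) (K : NNReal), LipschitzWith K f → μ (Set.range f) = 0

variable {Ω : Type*} [MeasurableSpace Ω]

/-- The σ-algebra `σ(ξ, η)` generated by the measure-valued maps `ξ` and `η`. -/
def sigmaGen {d : ℕ} (ξ η : Ω → Measure (Eucl d)) : MeasurableSpace Ω :=
  MeasurableSpace.comap ξ inferInstance ⊔ MeasurableSpace.comap η inferInstance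

/-- `T` is a factor allocation for `(ξ, η)` over the flow `θ`: it is jointly measurable,
equivariant, and measurable with respect to `σ(ξ, η)` (times the Borel σ-algebra). -/
def IsFactorAllocation {d : ℕ} (θ : Eucl d → Ω → Ω) (ξ η : Ω → Measure (Eucl d))
    (T : Ω → Eucl d → Eucl d) : Prop :=
  Measurable (Function.uncurry T) ∧
  (∀ (ω : Ω) (x y : Eucl d), T (θ x ω) y = T ω (y + x) - x) ∧
  Measurable[(sigmaGen ξ η).prod (inferInstance : MeasurableSpace (Eucl d))]
    (Function.uncurry T)

section Geometry

/-- A set all of whose chords make an angle bounded away from zero with the direction `p` is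
contained in the range of a Lipschitz map defined on a Euclidean space of one dimension less. -/
lemma exists_lipschitzWith_subset_range_of_inner_le {d : ℕ} (hd : 1 ≤ d) {S : Set (Eucl d)}
    {p : Eucl d} (hp : p ≠ 0)
    (hS : ∀ x ∈ S, ∀ y ∈ S, |inner ℝ p (y - x)| ≤ ‖p‖ / 2 * ‖y - x‖) :
    ∃ (f : Eucl (d - 1) → Eucl d) (K : NNReal), LipschitzWith K f ∧ S ⊆ range f := by
  have hfin : Module.finrank ℝ (Submodule.span ℝ {p})ᗮ = d - 1 := by
    have h1 := Submodule.finrank_add_finrank_orthogonal (Submodule.span ℝ {p})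
    rw [finrank_span_singleton hp, finrank_euclideanSpace_fin] at h1
    omega
  let e : (Submodule.span ℝ {p})ᗮ ≃ₗᵢ[ℝ] Eucl (d - 1) :=
    ((stdOrthonormalBasis ℝ (Submodule.span ℝ {p})ᗮ).reindex (finCongr hfin)).repr
  let g : Eucl d → Eucl (d - 1) := fun x => e ((Submodule.span ℝ {p})ᗮ.orthogonalProjectionOnto x)
  have hg : ∀ x ∈ S, ∀ y ∈ S, ‖y - x‖ ≤ 2 * ‖g y - g x‖ := by
    intro x hx y hy
    have h0 : ‖g y - g x‖ = ‖(Submodule.span ℝ {p})ᗮ.orthogonalProjectionOnto (y - x)‖ := by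
      simp only [g]
      rw [← map_sub, LinearIsometryEquiv.norm_map, map_sub]
    have h1 := Submodule.norm_sq_eq_add_norm_sq_projection (y - x) (Submodule.span ℝ {p})
    have h2 : ‖(Submodule.span ℝ {p}).orthogonalProjectionOnto (y - x)‖ ≤ ‖y - x‖ / 2 := by
      rw [← Submodule.norm_coe, ← Submodule.starProjection_apply,
        Submodule.starProjection_singleton, norm_smul]
      have hp' : 0 < ‖p‖ := norm_pos_iff.2 hp
      have h3 := hS x hx y hy
      simp only [norm_div, Real.norm_eq_abs, norm_pow, abs_norm, RCLike.ofReal_real_eq_id, id]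
      rw [div_mul_eq_mul_div, div_le_div_iff₀ (by positivity) (by positivity)]
      nlinarith [mul_le_mul_of_nonneg_right h3 hp'.le]
    rw [h0]
    have h3 := norm_nonneg (y - x)
    have h4 := norm_nonneg ((Submodule.span ℝ {p})ᗮ.orthogonalProjectionOnto (y - x))
    have h5 := norm_nonneg ((Submodule.span ℝ {p}).orthogonalProjectionOnto (y - x))
    nlinarith
  have hinj : InjOn g S := by
    intro x hx y hy hxy
    have := hg x hx y hy
    rw [hxy, sub_self, norm_zero, mul_zero] at this
    exact (sub_eq_zero.1 (norm_le_zero_iff.1 this)).symm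
  have hlip : LipschitzOnWith 2 (Function.invFunOn g S) (g '' S) := by
    refine LipschitzOnWith.of_dist_le_mul ?_
    rintro _ ⟨x, hx, rfl⟩ _ ⟨y, hy, rfl⟩
    rw [hinj.leftInvOn_invFunOn hx, hinj.leftInvOn_invFunOn hy, dist_eq_norm, dist_eq_norm]
    exact hg y hy x hx
  obtain ⟨f, hf, hfe⟩ := hlip.extend_finite_dimension
  refine ⟨f, _, hf, fun x hx => ⟨g x, ?_⟩⟩
  rw [← hfe (mem_image_of_mem g hx), hinj.leftInvOn_invFunOn hx]

lemma hasStrictFDerivAt_exp_neg_norm {E : Type*} [NormedAddCommGroup E] [InnerProductSpace ℝ E]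
    {v : E} (hv : v ≠ 0) :
    HasStrictFDerivAt (fun v : E => Real.exp (-‖v‖))
      (innerSL ℝ (-(Real.exp (-‖v‖) * ‖v‖⁻¹) • v)) v := by
  have hv' : ‖v‖ ≠ 0 := norm_ne_zero_iff.2 hv
  have h1 : HasStrictFDerivAt (fun v : E => ‖v‖) (innerSL ℝ (‖v‖⁻¹ • v)) v := by
    have h := (hasStrictFDerivAt_norm_sq v).sqrt (by positivity)
    simp only [Real.sqrt_sq (norm_nonneg _)] at h
    convert h using 1
    ext w
    simp
    field_simp
  convert h1.fun_neg.exp using 1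
  ext w
  simp
  ring

lemma exp_neg_norm_gradient_injective {E : Type*} [NormedAddCommGroup E] [InnerProductSpace ℝ E]
    {v w : E} (hv : v ≠ 0) (hw : w ≠ 0)
    (h : -(Real.exp (-‖v‖) * ‖v‖⁻¹) • v = -(Real.exp (-‖w‖) * ‖w‖⁻¹) • w) : v = w := by
  have hv' : ‖v‖ ≠ 0 := norm_ne_zero_iff.2 hv
  have hw' : ‖w‖ ≠ 0 := norm_ne_zero_iff.2 hw
  have hn : ‖v‖ = ‖w‖ := by
    have := congrArg norm h
    rw [norm_smul, norm_smul, norm_neg, norm_neg, norm_mul, norm_mul, norm_inv, norm_inv,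
      norm_norm, norm_norm, mul_assoc, mul_assoc, inv_mul_cancel₀ hv', inv_mul_cancel₀ hw',
      Real.norm_of_nonneg (Real.exp_pos _).le, Real.norm_of_nonneg (Real.exp_pos _).le] at this
    simpa using this
  rw [hn] at h
  refine smul_right_injective _ ?_ h
  simpa using norm_ne_zero_iff.2 hw

/-- Points at which the contact set of a pair of potentials for the reward `exp (-‖y - x‖)`
contains two distinct off-diagonal targets are negligible for measures not charging small sets. -/
lemma measure_multiple_contact_eq_zero {d : ℕ} (hd : 1 ≤ d) {φ ψ : Eucl d → ℝ}
    (h : ∀ x y, Real.exp (-‖y - x‖) ≤ φ x + ψ y) {μ : Measure (Eucl d)}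
    (hμ : DoesNotChargeSmallSets d μ) :
    μ {x | ∃ y z, y ≠ z ∧ y ≠ x ∧ z ≠ x ∧ φ x + ψ y = Real.exp (-‖y - x‖) ∧
      φ x + ψ z = Real.exp (-‖z - x‖)} = 0 := by
  let A : Set (Eucl d × Eucl d × Eucl d) := {q | q.2.1 ≠ q.2.2 ∧ q.2.1 ≠ q.1 ∧ q.2.2 ≠ q.1}
  let C : Set (Eucl d × Eucl d × Eucl d) := {q | φ q.1 + ψ q.2.1 = Real.exp (-‖q.2.1 - q.1‖) ∧
      φ q.1 + ψ q.2.2 = Real.exp (-‖q.2.2 - q.1‖)}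
  have key : ∀ q ∈ A, ∃ V ∈ nhdsWithin q A, μ (Prod.fst '' (V ∩ C)) = 0 := by
    rintro ⟨x, y, z⟩ ⟨hyz, hyx, hzx⟩
    simp only at hyz hyx hzx
    have hy := hasStrictFDerivAt_exp_neg_norm (sub_ne_zero.2 hyx)
    have hz := hasStrictFDerivAt_exp_neg_norm (sub_ne_zero.2 hzx)
    set a := -(Real.exp (-‖y - x‖) * ‖y - x‖⁻¹) • (y - x) with ha
    set b := -(Real.exp (-‖z - x‖) * ‖z - x‖⁻¹) • (z - x) with hb
    have hab : a - b ≠ 0 := fun hab => hyz <| sub_left_injective (b := x) <|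
      exp_neg_norm_gradient_injective (sub_ne_zero.2 hyx) (sub_ne_zero.2 hzx) (sub_eq_zero.1 hab)
    have hpos : 0 < ‖a - b‖ / 4 := by positivity
    have hy' := (hasStrictFDerivAt_iff_isLittleO.1 hy).def hpos
    have hz' := (hasStrictFDerivAt_iff_isLittleO.1 hz).def hpos
    rw [nhds_prod_eq, eventually_prod_self_iff'] at hy' hz'
    obtain ⟨U, hU, hUy⟩ := hy'
    obtain ⟨W, hW, hWz⟩ := hz'
    have cy : Continuous fun q : (Eucl d × Eucl d × Eucl d) × Eucl d => q.1.2.1 - q.2 := by fun_prop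
    have cz : Continuous fun q : (Eucl d × Eucl d × Eucl d) × Eucl d => q.1.2.2 - q.2 := by fun_prop
    have hN : ∀ᶠ q in nhds ((x, y, z), x),
        q.1.2.1 - q.2 ∈ U ∧ q.1.2.2 - q.2 ∈ W := Filter.Eventually.and
      (cy.tendsto' ((x, y, z), x) (y - x) rfl hU) (cz.tendsto' ((x, y, z), x) (z - x) rfl hW)
    rw [nhds_prod_eq] at hN
    obtain ⟨V1, hV1, V2, hV2, hV⟩ := (Filter.mem_prod_iff.1 hN)
    refine ⟨V1 ∩ Prod.fst ⁻¹' V2, mem_nhdsWithin_of_mem_nhds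
      (inter_mem hV1 (continuous_fst.tendsto _ hV2)), ?_⟩
    have one : ∀ q ∈ (V1 ∩ Prod.fst ⁻¹' V2) ∩ C, ∀ q' ∈ (V1 ∩ Prod.fst ⁻¹' V2) ∩ C,
        inner ℝ (a - b) (q.1 - q'.1) ≤ ‖a - b‖ / 2 * ‖q'.1 - q.1‖ := by
      rintro ⟨x₁, y₁, z₁⟩ ⟨⟨h1, h2⟩, c1, c2⟩ ⟨x₂, y₂, z₂⟩ ⟨⟨h3, h4⟩, c3, c4⟩
      simp only [mem_preimage] at h2 h4 c1 c2 c3 c4 ⊢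
      have m1 := (hV (mk_mem_prod h1 h2)).1
      have m2 := (hV (mk_mem_prod h1 h4)).1
      have m3 := (hV (mk_mem_prod h3 h4)).2
      have m4 := (hV (mk_mem_prod h3 h2)).2
      simp only at m1 m2 m3 m4
      have e1 := hUy _ m1 _ m2
      have e2 := hWz _ m3 _ m4
      have f1 := h x₂ y₁
      have f2 := h x₁ z₂
      simp only [innerSL_apply_apply, Real.norm_eq_abs] at e1 e2
      rw [show y₁ - x₁ - (y₁ - x₂) = x₂ - x₁ by abel] at e1
      rw [show z₂ - x₂ - (z₂ - x₁) = x₁ - x₂ by abel, norm_sub_rev x₁ x₂,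
        show x₁ - x₂ = -(x₂ - x₁) by abel, inner_neg_right] at e2
      rw [show x₁ - x₂ = -(x₂ - x₁) by abel, inner_neg_right, inner_sub_left]
      have := (abs_le.1 e1)
      have := (abs_le.1 e2)
      linarith
    obtain ⟨f, K, hf, hsub⟩ := exists_lipschitzWith_subset_range_of_inner_le hd
      (S := Prod.fst '' ((V1 ∩ Prod.fst ⁻¹' V2) ∩ C)) hab (by
        rintro _ ⟨q, hq, rfl⟩ _ ⟨q', hq', rfl⟩
        rw [abs_le]
        constructor
        · have := one q hq q' hq'
          rw [← neg_sub q'.1 q.1, inner_neg_right] at this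
          linarith
        · have := one q' hq' q hq
          rwa [norm_sub_rev q.1 q'.1] at this)
    exact measure_mono_null hsub (hμ f K hf)
  choose! V hVn hV0 using key
  obtain ⟨t, htA, htc, hcov⟩ := TopologicalSpace.countable_cover_nhdsWithin hVn
  refine measure_mono_null ?_ ((measure_biUnion_null_iff htc).2 fun q hq => hV0 q (htA hq))
  rintro x ⟨y, z, hyz, hyx, hzx, hy, hz⟩
  have hm := hcov (show (x, y, z) ∈ A from ⟨hyz, hyx, hzx⟩)
  obtain ⟨q, hq, hqm⟩ := mem_iUnion₂.1 hm
  exact mem_iUnion₂.2 ⟨q, hq, (x, y, z), ⟨hqm, hy, hz⟩, rfl⟩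

end Geometry

section Flow

variable {d : ℕ}

/-- A jointly measurable flow indexed by `ℝ^d`. -/
structure IsFlow (θ : Eucl d → Ω → Ω) : Prop where
  measurable_uncurry : Measurable fun p : Eucl d × Ω => θ p.1 p.2
  zero : ∀ ω, θ 0 ω = ω
  add : ∀ (x y : Eucl d) (ω : Ω), θ y (θ x ω) = θ (x + y) ω

lemma IsFlow.measurable {θ : Eucl d → Ω → Ω} (hθ : IsFlow θ) (x : Eucl d) : Measurable (θ x) :=
  hθ.measurable_uncurry.comp (measurable_const.prodMk measurable_id)

lemma IsFlow.neg_add_self {θ : Eucl d → Ω → Ω} (hθ : IsFlow θ) (x : Eucl d) (ω : Ω) :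
    θ (-x) (θ x ω) = ω := by
  rw [hθ.add, add_neg_cancel, hθ.zero]

end Flow

section Potentials

variable {d : ℕ} {θ : Eucl d → Ω → Ω}

/-- The transform of a potential on `Ω` along the orbits of the flow, with respect to the reward
`exp (-‖v‖)` and an outside option of reward zero. -/
def cTransform (θ : Eucl d → Ω → Ω) (Ψ : Ω → ℝ) (ω : Ω) : ℝ :=
  ⨆ v : Eucl d, max 0 (Real.exp (-‖v‖) - Ψ (θ v ω))

lemma exp_neg_norm_le_one (v : Eucl d) : Real.exp (-‖v‖) ≤ 1 :=
  Real.exp_le_one_iff.2 (neg_nonpos.2 (norm_nonneg v))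

lemma bddAbove_cTransform {Ψ : Ω → ℝ} (h0 : ∀ ω, 0 ≤ Ψ ω) (ω : Ω) :
    BddAbove (range fun v : Eucl d => max 0 (Real.exp (-‖v‖) - Ψ (θ v ω))) := by
  refine ⟨1, ?_⟩
  rintro _ ⟨v, rfl⟩
  exact max_le zero_le_one (by linarith [exp_neg_norm_le_one v, h0 (θ v ω)])

lemma cTransform_le {Ψ : Ω → ℝ} {ω : Ω} {a : ℝ} (ha : 0 ≤ a)
    (h : ∀ v : Eucl d, Real.exp (-‖v‖) - Ψ (θ v ω) ≤ a) : cTransform θ Ψ ω ≤ a :=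
  ciSup_le fun v => max_le ha (h v)

lemma cTransform_nonneg (Ψ : Ω → ℝ) (ω : Ω) : 0 ≤ cTransform θ Ψ ω :=
  Real.iSup_nonneg fun _ => le_max_left _ _

lemma cTransform_le_one {Ψ : Ω → ℝ} (h0 : ∀ ω, 0 ≤ Ψ ω) (ω : Ω) : cTransform θ Ψ ω ≤ 1 :=
  cTransform_le zero_le_one fun v => by linarith [exp_neg_norm_le_one v, h0 (θ v ω)]

lemma exp_le_cTransform_add {Ψ : Ω → ℝ} (h0 : ∀ ω, 0 ≤ Ψ ω) (ω : Ω) (v : Eucl d) :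
    Real.exp (-‖v‖) ≤ cTransform θ Ψ ω + Ψ (θ v ω) := by
  have := (le_max_right 0 _).trans (le_ciSup (bddAbove_cTransform (θ := θ) h0 ω) v)
  unfold cTransform
  linarith

/-- A function on `Ω` which is continuous along the orbits of the flow. -/
def OrbitContinuous (θ : Eucl d → Ω → Ω) (H : Ω → ℝ) : Prop :=
  ∀ ω, Continuous fun x => H (θ x ω)

/-- A function on `Ω` which is `1`-Lipschitz along the orbits of the flow. -/
def OrbitLipschitz (θ : Eucl d → Ω → Ω) (H : Ω → ℝ) : Prop :=
  ∀ ω x, H (θ x ω) ≤ H ω + ‖x‖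

lemma OrbitLipschitz.orbitContinuous (hθ : IsFlow θ) {H : Ω → ℝ} (h : OrbitLipschitz θ H) :
    OrbitContinuous θ H := by
  intro ω
  refine (LipschitzWith.of_le_add fun x y => ?_).continuous
  have := h (θ y ω) (x - y)
  rwa [hθ.add, add_sub_cancel, ← dist_eq_norm] at this

lemma exp_neg_norm_le_add (v w : Eucl d) :
    Real.exp (-‖v‖) ≤ Real.exp (-‖w + v‖) + ‖w‖ := by
  have h1 : ‖w + v‖ ≤ ‖w‖ + ‖v‖ := norm_add_le w v
  have h2 : Real.exp (-‖w‖ + -‖v‖) ≤ Real.exp (-‖w + v‖) := Real.exp_le_exp.2 (by linarith)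
  rw [Real.exp_add] at h2
  have h3 := Real.add_one_le_exp (-‖w‖)
  have h4 := exp_neg_norm_le_one v
  have h5 := Real.exp_pos (-‖v‖)
  have h6 := norm_nonneg w
  nlinarith

lemma orbitLipschitz_cTransform (hθ : IsFlow θ) {Ψ : Ω → ℝ} (h0 : ∀ ω, 0 ≤ Ψ ω) :
    OrbitLipschitz θ (cTransform θ Ψ) := by
  intro ω x
  refine cTransform_le (add_nonneg (cTransform_nonneg _ _) (norm_nonneg _)) fun v => ?_
  have h1 := exp_le_cTransform_add (θ := θ) h0 ω (x + v)
  rw [hθ.add]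
  linarith [exp_neg_norm_le_add v x]

lemma cTransform_cTransform_le (hθ : IsFlow θ) {Ψ : Ω → ℝ} (h0 : ∀ ω, 0 ≤ Ψ ω) (ω : Ω) :
    cTransform θ (cTransform θ Ψ) ω ≤ Ψ ω := by
  refine cTransform_le (h0 ω) fun v => ?_
  have h1 := exp_le_cTransform_add (θ := θ) h0 (θ v ω) (-v)
  rw [hθ.neg_add_self, norm_neg] at h1
  linarith

lemma measurable_cTransform (hθ : IsFlow θ) {Ψ : Ω → ℝ} (hm : Measurable Ψ)
    (h0 : ∀ ω, 0 ≤ Ψ ω) (hc : OrbitContinuous θ Ψ) : Measurable (cTransform θ Ψ) := by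
  refine measurable_of_Ioi fun a => ?_
  have : cTransform θ Ψ ⁻¹' Ioi a = ⋃ n : ℕ, {ω | a < max 0
      (Real.exp (-‖TopologicalSpace.denseSeq (Eucl d) n‖) -
        Ψ (θ (TopologicalSpace.denseSeq (Eucl d) n) ω))} := by
    ext ω
    simp only [mem_preimage, mem_Ioi, mem_iUnion, mem_ofPred_eq, cTransform]
    rw [lt_ciSup_iff (bddAbove_cTransform h0 ω)]
    refine ⟨fun ⟨v, hv⟩ => ?_, fun ⟨n, hn⟩ => ⟨_, hn⟩⟩
    have hc' : Continuous fun v : Eucl d => max 0 (Real.exp (-‖v‖) - Ψ (θ v ω)) :=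
      continuous_const.max ((Real.continuous_exp.comp continuous_norm.neg).sub (hc ω))
    exact (TopologicalSpace.denseRange_denseSeq (Eucl d)).exists_mem_open
      (isOpen_Ioi.preimage hc') ⟨v, hv⟩
  rw [this]
  refine MeasurableSet.iUnion fun n => measurableSet_lt measurable_const ?_
  exact measurable_const.max (measurable_const.sub (hm.comp (hθ.measurable _)))

/-- Admissible pairs of potentials for the dual of the transport problem with reward
`exp (-‖v‖)`. -/
structure Admissible (θ : Eucl d → Ω → Ω) (Φ Ψ : Ω → ℝ) : Prop where
  measurable_left : Measurable Φ
  measurable_right : Measurable Ψ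
  left_mem : ∀ ω, Φ ω ∈ Icc (0 : ℝ) 1
  right_mem : ∀ ω, Ψ ω ∈ Icc (0 : ℝ) 1
  left_lipschitz : OrbitLipschitz θ Φ
  right_lipschitz : OrbitLipschitz θ Ψ
  le_add : ∀ ω v, Real.exp (-‖v‖) ≤ Φ ω + Ψ (θ v ω)

/-- The dual cost of a pair of potentials. -/
def dualCost (μ ν : Measure Ω) (Φ Ψ : Ω → ℝ) : ℝ := ∫ ω, Φ ω ∂μ + ∫ ω, Ψ ω ∂ν

lemma admissible_cTransform (hθ : IsFlow θ) {Ψ : Ω → ℝ} (hm : Measurable Ψ)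
    (h0 : ∀ ω, 0 ≤ Ψ ω) (hc : OrbitContinuous θ Ψ) :
    Admissible θ (cTransform θ Ψ) (cTransform θ (cTransform θ Ψ)) where
  measurable_left := measurable_cTransform hθ hm h0 hc
  measurable_right := measurable_cTransform hθ (measurable_cTransform hθ hm h0 hc)
    (cTransform_nonneg _) ((orbitLipschitz_cTransform hθ h0).orbitContinuous hθ)
  left_mem ω := ⟨cTransform_nonneg _ _, cTransform_le_one h0 _⟩
  right_mem ω := ⟨cTransform_nonneg _ _, cTransform_le_one (cTransform_nonneg _) _⟩
  left_lipschitz := orbitLipschitz_cTransform hθ h0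
  right_lipschitz := orbitLipschitz_cTransform hθ (cTransform_nonneg _)
  le_add ω v := by
    have h1 := exp_le_cTransform_add (θ := θ) (cTransform_nonneg (θ := θ) Ψ) (θ v ω) (-v)
    rw [hθ.neg_add_self, norm_neg] at h1
    linarith

lemma integrable_of_mem_Icc {μ : Measure Ω} [IsFiniteMeasure μ] {Φ : Ω → ℝ} (hm : Measurable Φ)
    (h : ∀ ω, Φ ω ∈ Icc (0 : ℝ) 1) : Integrable Φ μ :=
  Integrable.of_bound hm.aestronglyMeasurable 1 <| ae_of_all _ fun ω => by
    rw [Real.norm_of_nonneg (h ω).1]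
    exact (h ω).2

lemma Admissible.sup_inf {Φ Ψ Φ' Ψ' : Ω → ℝ} (h : Admissible θ Φ Ψ) (h' : Admissible θ Φ' Ψ') :
    Admissible θ (fun ω => max (Φ ω) (Φ' ω)) (fun ω => min (Ψ ω) (Ψ' ω)) where
  measurable_left := h.measurable_left.max h'.measurable_left
  measurable_right := h.measurable_right.min h'.measurable_right
  left_mem ω := ⟨le_max_of_le_left (h.left_mem ω).1, max_le (h.left_mem ω).2 (h'.left_mem ω).2⟩
  right_mem ω := ⟨le_min (h.right_mem ω).1 (h'.right_mem ω).1, min_le_of_left_le (h.right_mem ω).2⟩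
  left_lipschitz ω x := by
    rw [← max_add_add_right]
    exact max_le_max (h.left_lipschitz ω x) (h'.left_lipschitz ω x)
  right_lipschitz ω x := by
    rw [← min_add_add_right]
    exact min_le_min (h.right_lipschitz ω x) (h'.right_lipschitz ω x)
  le_add ω v := by
    have h1 := h.le_add ω v
    have h2 := h'.le_add ω v
    rcases min_choice (Ψ (θ v ω)) (Ψ' (θ v ω)) with h3 | h3 <;> rw [h3] <;>
      linarith [le_max_left (Φ ω) (Φ' ω), le_max_right (Φ ω) (Φ' ω)]

lemma Admissible.inf_sup {Φ Ψ Φ' Ψ' : Ω → ℝ} (h : Admissible θ Φ Ψ) (h' : Admissible θ Φ' Ψ') :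
    Admissible θ (fun ω => min (Φ ω) (Φ' ω)) (fun ω => max (Ψ ω) (Ψ' ω)) where
  measurable_left := h.measurable_left.min h'.measurable_left
  measurable_right := h.measurable_right.max h'.measurable_right
  left_mem ω := ⟨le_min (h.left_mem ω).1 (h'.left_mem ω).1, min_le_of_left_le (h.left_mem ω).2⟩
  right_mem ω := ⟨le_max_of_le_left (h.right_mem ω).1, max_le (h.right_mem ω).2 (h'.right_mem ω).2⟩
  left_lipschitz ω x := by
    rw [← min_add_add_right]
    exact min_le_min (h.left_lipschitz ω x) (h'.left_lipschitz ω x)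
  right_lipschitz ω x := by
    rw [← max_add_add_right]
    exact max_le_max (h.right_lipschitz ω x) (h'.right_lipschitz ω x)
  le_add ω v := by
    have h1 := h.le_add ω v
    have h2 := h'.le_add ω v
    rcases min_choice (Φ ω) (Φ' ω) with h3 | h3 <;> rw [h3] <;>
      linarith [le_max_left (Ψ (θ v ω)) (Ψ' (θ v ω)), le_max_right (Ψ (θ v ω)) (Ψ' (θ v ω))]

lemma Admissible.dualCost_sup_inf_add {μ ν : Measure Ω} [IsFiniteMeasure μ] [IsFiniteMeasure ν]
    {Φ Ψ Φ' Ψ' : Ω → ℝ} (h : Admissible θ Φ Ψ) (h' : Admissible θ Φ' Ψ') :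
    dualCost μ ν (fun ω => max (Φ ω) (Φ' ω)) (fun ω => min (Ψ ω) (Ψ' ω)) +
      dualCost μ ν (fun ω => min (Φ ω) (Φ' ω)) (fun ω => max (Ψ ω) (Ψ' ω)) =
    dualCost μ ν Φ Ψ + dualCost μ ν Φ' Ψ' := by
  have a := h.sup_inf h'
  have b := h.inf_sup h'
  have e1 : ∫ ω, max (Φ ω) (Φ' ω) ∂μ + ∫ ω, min (Φ ω) (Φ' ω) ∂μ =
      ∫ ω, Φ ω ∂μ + ∫ ω, Φ' ω ∂μ := by
    rw [← integral_add (integrable_of_mem_Icc a.measurable_left a.left_mem)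
        (integrable_of_mem_Icc b.measurable_left b.left_mem),
      ← integral_add (integrable_of_mem_Icc h.measurable_left h.left_mem)
        (integrable_of_mem_Icc h'.measurable_left h'.left_mem)]
    simp only [max_add_min]
  have e2 : ∫ ω, min (Ψ ω) (Ψ' ω) ∂ν + ∫ ω, max (Ψ ω) (Ψ' ω) ∂ν =
      ∫ ω, Ψ ω ∂ν + ∫ ω, Ψ' ω ∂ν := by
    rw [← integral_add (integrable_of_mem_Icc a.measurable_right a.right_mem)
        (integrable_of_mem_Icc b.measurable_right b.right_mem),
      ← integral_add (integrable_of_mem_Icc h.measurable_right h.right_mem)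
        (integrable_of_mem_Icc h'.measurable_right h'.right_mem)]
    simp only [min_add_max]
  unfold dualCost
  linarith

lemma Admissible.of_tendsto {F G : ℕ → Ω → ℝ} {Φ Ψ : Ω → ℝ} (h : ∀ n, Admissible θ (F n) (G n))
    (hF : ∀ ω, Tendsto (fun n => F n ω) atTop (nhds (Φ ω)))
    (hG : ∀ ω, Tendsto (fun n => G n ω) atTop (nhds (Ψ ω))) : Admissible θ Φ Ψ where
  measurable_left := measurable_of_tendsto_metrizable (fun n => (h n).measurable_left)
    (tendsto_pi_nhds.2 hF)
  measurable_right := measurable_of_tendsto_metrizable (fun n => (h n).measurable_right)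
    (tendsto_pi_nhds.2 hG)
  left_mem ω := isClosed_Icc.mem_of_tendsto (hF ω) (Eventually.of_forall fun n => (h n).left_mem ω)
  right_mem ω := isClosed_Icc.mem_of_tendsto (hG ω)
    (Eventually.of_forall fun n => (h n).right_mem ω)
  left_lipschitz ω x := le_of_tendsto_of_tendsto' (hF _) ((hF ω).add_const _)
    fun n => (h n).left_lipschitz ω x
  right_lipschitz ω x := le_of_tendsto_of_tendsto' (hG _) ((hG ω).add_const _)
    fun n => (h n).right_lipschitz ω x
  le_add ω v := ge_of_tendsto' ((hF ω).add (hG _)) fun n => (h n).le_add ω v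

lemma Admissible.tendsto_dualCost {μ ν : Measure Ω} [IsFiniteMeasure μ] [IsFiniteMeasure ν]
    {F G : ℕ → Ω → ℝ} {Φ Ψ : Ω → ℝ} (h : ∀ n, Admissible θ (F n) (G n))
    (hF : ∀ ω, Tendsto (fun n => F n ω) atTop (nhds (Φ ω)))
    (hG : ∀ ω, Tendsto (fun n => G n ω) atTop (nhds (Ψ ω))) :
    Tendsto (fun n => dualCost μ ν (F n) (G n)) atTop (nhds (dualCost μ ν Φ Ψ)) := by
  refine Tendsto.add ?_ ?_
  · refine tendsto_integral_of_dominated_convergence (fun _ => 1)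
      (fun n => (h n).measurable_left.aestronglyMeasurable) (integrable_const _)
      (fun n => ae_of_all _ fun ω => ?_) (ae_of_all _ hF)
    rw [Real.norm_of_nonneg ((h n).left_mem ω).1]
    exact ((h n).left_mem ω).2
  · refine tendsto_integral_of_dominated_convergence (fun _ => 1)
      (fun n => (h n).measurable_right.aestronglyMeasurable) (integrable_const _)
      (fun n => ae_of_all _ fun ω => ?_) (ae_of_all _ hG)
    rw [Real.norm_of_nonneg ((h n).right_mem ω).1]
    exact ((h n).right_mem ω).2

lemma Admissible.dualCost_nonneg {μ ν : Measure Ω} {Φ Ψ : Ω → ℝ} (h : Admissible θ Φ Ψ) :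
    0 ≤ dualCost μ ν Φ Ψ :=
  add_nonneg (integral_nonneg fun ω => (h.left_mem ω).1) (integral_nonneg fun ω => (h.right_mem ω).1)

/-- The dual problem has a minimizer. -/
lemma exists_admissible_dualCost_le (hθ : IsFlow θ) (μ ν : Measure Ω) [IsFiniteMeasure μ]
    [IsFiniteMeasure ν] :
    ∃ Φ Ψ, Admissible θ Φ Ψ ∧
      ∀ Φ' Ψ', Admissible θ Φ' Ψ' → dualCost μ ν Φ Ψ ≤ dualCost μ ν Φ' Ψ' := by
  let S : Set ℝ := {r | ∃ Φ Ψ, Admissible θ Φ Ψ ∧ dualCost μ ν Φ Ψ = r}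
  have hne : S.Nonempty :=
    ⟨_, _, _, admissible_cTransform hθ (Ψ := fun _ => 0) measurable_const (fun _ => le_rfl)
      (fun _ => continuous_const), rfl⟩
  have hbdd : BddBelow S := ⟨0, by rintro _ ⟨Φ, Ψ, h, rfl⟩; exact h.dualCost_nonneg⟩
  have hm : ∀ Φ Ψ, Admissible θ Φ Ψ → sInf S ≤ dualCost μ ν Φ Ψ := fun Φ Ψ h =>
    csInf_le hbdd ⟨Φ, Ψ, h, rfl⟩
  have happrox : ∀ n : ℕ, ∃ Φ Ψ, Admissible θ Φ Ψ ∧ dualCost μ ν Φ Ψ ≤ sInf S + (1 / 2) ^ n := by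
    intro n
    obtain ⟨_, ⟨Φ, Ψ, h, rfl⟩, hlt⟩ := exists_lt_of_csInf_lt hne
      (show sInf S < sInf S + (1 / 2) ^ n from lt_add_of_pos_right _ (by positivity))
    exact ⟨Φ, Ψ, h, hlt.le⟩
  choose Φ Ψ hadm hcost using happrox
  have hbΦ : ∀ n ω, BddAbove (range fun k => Φ (n + k) ω) := fun n ω =>
    ⟨1, by rintro _ ⟨k, rfl⟩; exact ((hadm _).left_mem ω).2⟩
  have hbΨ : ∀ n ω, BddBelow (range fun k => Ψ (n + k) ω) := fun n ω =>
    ⟨0, by rintro _ ⟨k, rfl⟩; exact ((hadm _).right_mem ω).1⟩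
  let F : ℕ → ℕ → Ω → ℝ := fun n j ω => partialSups (fun k => Φ (n + k) ω) j
  let G : ℕ → ℕ → Ω → ℝ := fun n j ω => -partialSups (fun k => -Ψ (n + k) ω) j
  have hFs : ∀ n j, F n (j + 1) = fun ω => max (F n j ω) (Φ (n + (j + 1)) ω) := fun n j => by
    ext ω; exact partialSups_add_one _ _
  have hGs : ∀ n j, G n (j + 1) = fun ω => min (G n j ω) (Ψ (n + (j + 1)) ω) := fun n j => by
    ext ω
    simp only [G, partialSups_add_one]
    rw [neg_sup, neg_neg]
  have hFG : ∀ n j, Admissible θ (F n j) (G n j) ∧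
      dualCost μ ν (F n j) (G n j) ≤ sInf S + 2 * (1 / 2) ^ n - (1 / 2) ^ (n + j) := by
    intro n j
    induction j with
    | zero =>
      have h1 : F n 0 = Φ n := by ext ω; simp [F]
      have h2 : G n 0 = Ψ n := by ext ω; simp [G]
      rw [h1, h2]
      exact ⟨hadm n, by have := hcost n; simp only [add_zero]; linarith⟩
    | succ j ih =>
      rw [hFs, hGs]
      refine ⟨ih.1.sup_inf (hadm _), ?_⟩
      have h1 := ih.1.dualCost_sup_inf_add (μ := μ) (ν := ν) (hadm (n + (j + 1)))
      have h2 := hm _ _ (ih.1.inf_sup (hadm (n + (j + 1))))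
      have h3 := hcost (n + (j + 1))
      have h4 : (1 / 2 : ℝ) ^ (n + j) = 2 * (1 / 2) ^ (n + (j + 1)) := by
        rw [← add_assoc, pow_succ]; ring
      linarith [ih.2]
  let A : ℕ → Ω → ℝ := fun n ω => ⨆ k, Φ (n + k) ω
  let I : ℕ → Ω → ℝ := fun n ω => ⨅ k, Ψ (n + k) ω
  have hFA : ∀ n ω, Tendsto (fun j => F n j ω) atTop (nhds (A n ω)) := fun n ω => by
    have h1 := tendsto_atTop_ciSup (partialSups (fun k => Φ (n + k) ω)).monotone
      (bddAbove_range_partialSups.2 (hbΦ n ω))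
    rwa [ciSup_partialSups_eq (hbΦ n ω)] at h1
  have hGI : ∀ n ω, Tendsto (fun j => G n j ω) atTop (nhds (I n ω)) := fun n ω => by
    have hb : BddAbove (range fun k => -Ψ (n + k) ω) :=
      ⟨0, by rintro _ ⟨k, rfl⟩; exact neg_nonpos.2 ((hadm _).right_mem ω).1⟩
    have h1 := tendsto_atTop_ciSup (partialSups (fun k => -Ψ (n + k) ω)).monotone
      (bddAbove_range_partialSups.2 hb)
    rw [ciSup_partialSups_eq hb] at h1
    have h2 := h1.neg
    convert h2 using 2
    exact le_antisymm (le_neg_of_le_neg (ciSup_le fun i => neg_le_neg (ciInf_le (hbΨ n ω) i)))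
      (le_ciInf fun i => neg_le.1 (le_ciSup hb i))
  have hAI : ∀ n, Admissible θ (A n) (I n) := fun n =>
    Admissible.of_tendsto (fun j => (hFG n j).1) (hFA n) (hGI n)
  have hAIc : ∀ n, dualCost μ ν (A n) (I n) ≤ sInf S + 2 * (1 / 2) ^ n := fun n => by
    refine le_of_tendsto' (Admissible.tendsto_dualCost (fun j => (hFG n j).1) (hFA n) (hGI n))
      fun j => (hFG n j).2.trans ?_
    have : (0 : ℝ) < (1 / 2) ^ (n + j) := by positivity
    linarith
  have hAanti : ∀ ω, Antitone fun n => A n ω := fun ω => antitone_nat_of_succ_le fun n =>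
    ciSup_le fun k => by
      have := le_ciSup (hbΦ n ω) (1 + k)
      rwa [← add_assoc] at this
  have hImono : ∀ ω, Monotone fun n => I n ω := fun ω => monotone_nat_of_le_succ fun n =>
    le_ciInf fun k => by
      have := ciInf_le (hbΨ n ω) (1 + k)
      rwa [← add_assoc] at this
  have hA : ∀ ω, Tendsto (fun n => A n ω) atTop (nhds (⨅ n, A n ω)) := fun ω =>
    tendsto_atTop_ciInf (hAanti ω) ⟨0, by rintro _ ⟨k, rfl⟩; exact ((hAI k).left_mem ω).1⟩
  have hI : ∀ ω, Tendsto (fun n => I n ω) atTop (nhds (⨆ n, I n ω)) := fun ω =>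
    tendsto_atTop_ciSup (hImono ω) ⟨1, by rintro _ ⟨k, rfl⟩; exact ((hAI k).right_mem ω).2⟩
  refine ⟨_, _, Admissible.of_tendsto hAI hA hI, fun Φ' Ψ' h' => le_trans ?_ (hm Φ' Ψ' h')⟩
  refine le_of_tendsto_of_tendsto' (Admissible.tendsto_dualCost hAI hA hI) (b := atTop) ?_ hAIc
  have : Tendsto (fun n : ℕ => sInf S + 2 * (1 / 2 : ℝ) ^ n) atTop (nhds (sInf S + 2 * 0)) :=
    ((tendsto_pow_atTop_nhds_zero_of_lt_one (by norm_num) (by norm_num)).const_mul 2).const_add _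
  simpa using this

end Potentials

section Perturbation

variable {d : ℕ} {θ : Eucl d → Ω → Ω} {Φ Ψ H : Ω → ℝ}

/-- If the contact set of `ω` is contained in `{H > a}`, then the gap in the dual constraint is
bounded away from zero on `{H ≤ a}`. -/
lemma Admissible.exists_pos_le_gap (hadm : Admissible θ Φ Ψ) (hθ : IsFlow θ)
    (hH : OrbitContinuous θ H) {ω : Ω} {a ε : ℝ} (ha : a < 1) (hε : 0 < ε)
    (hcontact : ∀ v, Φ ω + Ψ (θ v ω) = Real.exp (-‖v‖) → a < H (θ v ω))
    (hco : ∀ v, H (θ v ω) < 1 → ε ≤ Φ ω + Ψ (θ v ω)) :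
    ∃ δ > 0, ∀ v, H (θ v ω) ≤ a → δ ≤ Φ ω + Ψ (θ v ω) - Real.exp (-‖v‖) := by
  obtain ⟨R, hR⟩ : ∃ R : ℝ, ∀ r, R ≤ r → Real.exp (-r) < ε / 2 :=
    eventually_atTop.1 ((Real.tendsto_exp_neg_atTop_nhds_zero).eventually_lt_const (half_pos hε))
  let K : Set (Eucl d) := Metric.closedBall 0 R ∩ {v | H (θ v ω) ≤ a}
  have hK : IsCompact K := (isCompact_closedBall _ _).inter_right
    (isClosed_le (hH ω) continuous_const)
  have hf : Continuous fun v : Eucl d => Φ ω + Ψ (θ v ω) - Real.exp (-‖v‖) :=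
    (continuous_const.add (hadm.right_lipschitz.orbitContinuous hθ ω)).sub
      (Real.continuous_exp.comp continuous_norm.neg)
  have hfar : ∀ v : Eucl d, R ≤ ‖v‖ → H (θ v ω) ≤ a →
      ε / 2 ≤ Φ ω + Ψ (θ v ω) - Real.exp (-‖v‖) := fun v hv hva => by
    linarith [hco v (hva.trans_lt ha), hR _ hv]
  rcases K.eq_empty_or_nonempty with hKe | hKne
  · refine ⟨ε / 2, half_pos hε, fun v hv => hfar v ?_ hv⟩
    by_contra! hlt
    have : v ∈ K := ⟨by simpa using hlt.le, hv⟩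
    rw [hKe] at this
    exact this
  · obtain ⟨v₀, hv₀, hmin⟩ := hK.exists_isMinOn hKne hf.continuousOn
    have hpos : 0 < Φ ω + Ψ (θ v₀ ω) - Real.exp (-‖v₀‖) := by
      refine lt_of_le_of_ne (by linarith [hadm.le_add ω v₀]) fun h => ?_
      exact absurd (hcontact v₀ (by linarith)) (not_lt.2 hv₀.2)
    refine ⟨min (ε / 2) _, lt_min (half_pos hε) hpos, fun v hv => ?_⟩
    rcases le_total R ‖v‖ with h | h
    · exact (min_le_left _ _).trans (hfar v h hv)
    · exact (min_le_right _ _).trans (hmin (show v ∈ K from ⟨by simpa using h, hv⟩))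

/-- First order optimality: perturbing `Ψ` in the direction `H - s`. -/
lemma Admissible.integral_perturbation_le {μ ν : Measure Ω} [IsFiniteMeasure μ]
    [IsFiniteMeasure ν] (hmass : μ univ = ν univ) (hadm : Admissible θ Φ Ψ) (hθ : IsFlow θ)
    (hmin : ∀ Φ' Ψ', Admissible θ Φ' Ψ' → dualCost μ ν Φ Ψ ≤ dualCost μ ν Φ' Ψ')
    (hHm : Measurable H) (hH : OrbitContinuous θ H) (hH01 : ∀ ω, H ω ∈ Icc (0 : ℝ) 1) {s r : ℝ}
    (hr : 0 < r) (h0 : ∀ ω, 0 ≤ Ψ ω + (H ω - s) / r) :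
    ∫ ω, (r * (Φ ω - cTransform θ (fun ω => Ψ ω + (H ω - s) / r) ω) + s) ∂μ ≤ ∫ ω, H ω ∂ν := by
  set Ψ' : Ω → ℝ := fun ω => Ψ ω + (H ω - s) / r with hΨ'
  have hΨ'm : Measurable Ψ' := hadm.measurable_right.add ((hHm.sub_const s).div_const r)
  have hΨ'c : OrbitContinuous θ Ψ' := fun ω =>
    (hadm.right_lipschitz.orbitContinuous hθ ω).add (((hH ω).sub continuous_const).div_const r)
  have hadm' := admissible_cTransform hθ hΨ'm h0 hΨ'c
  have hle := hmin _ _ hadm'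
  have iΦ := integrable_of_mem_Icc (μ := μ) hadm.measurable_left hadm.left_mem
  have iΦ' := integrable_of_mem_Icc (μ := μ) hadm'.measurable_left hadm'.left_mem
  have iΨ := integrable_of_mem_Icc (μ := ν) hadm.measurable_right hadm.right_mem
  have iΨ' := integrable_of_mem_Icc (μ := ν) hadm'.measurable_right hadm'.right_mem
  have iH := integrable_of_mem_Icc (μ := ν) hHm hH01
  have iHs : Integrable (fun ω => (H ω - s) / r) ν := (iH.sub (integrable_const s)).div_const r
  have iΦs : Integrable (fun ω => r * (Φ ω - cTransform θ Ψ' ω)) μ := (iΦ.sub iΦ').const_mul r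
  have h1 : ∫ ω, cTransform θ (cTransform θ Ψ') ω ∂ν ≤ ∫ ω, Ψ' ω ∂ν :=
    integral_mono iΨ' (iΨ.add iHs)
      (cTransform_cTransform_le hθ h0)
  have h2 : ∫ ω, Ψ' ω ∂ν = ∫ ω, Ψ ω ∂ν + (∫ ω, H ω ∂ν - s * ν.real univ) / r := by
    rw [hΨ', integral_add iΨ iHs, integral_div,
      integral_sub iH (integrable_const s), integral_const, smul_eq_mul, mul_comm s]
  have h3 : ∫ ω, (r * (Φ ω - cTransform θ Ψ' ω) + s) ∂μ =
      r * (∫ ω, Φ ω ∂μ - ∫ ω, cTransform θ Ψ' ω ∂μ) + s * ν.real univ := by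
    rw [integral_add iΦs (integrable_const s), integral_const_mul,
      integral_sub iΦ iΦ', integral_const, smul_eq_mul, mul_comm s, measureReal_def,
      measureReal_def, hmass]
  unfold dualCost at hle
  rw [h3]
  have h4 : ∫ ω, Φ ω ∂μ - ∫ ω, cTransform θ Ψ' ω ∂μ ≤ (∫ ω, H ω ∂ν - s * ν.real univ) / r := by
    linarith
  rw [le_div_iff₀ hr] at h4
  linarith

/-- The limiting form of `Admissible.integral_perturbation_le`. -/
lemma Admissible.lintegral_min_le_of_coercive {μ ν : Measure Ω} [IsFiniteMeasure μ]
    [IsFiniteMeasure ν] (hmass : μ univ = ν univ) (hadm : Admissible θ Φ Ψ) (hθ : IsFlow θ)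
    (hmin : ∀ Φ' Ψ', Admissible θ Φ' Ψ' → dualCost μ ν Φ Ψ ≤ dualCost μ ν Φ' Ψ')
    (hHm : Measurable H) (hH : OrbitContinuous θ H) (hH01 : ∀ ω, H ω ∈ Icc (0 : ℝ) 1)
    {τ : Ω → Eucl d}
    (hτ : ∀ᵐ ω ∂μ, ∀ v, Φ ω + Ψ (θ v ω) = Real.exp (-‖v‖) → v = 0 ∨ v = τ ω)
    {s : ℝ} {m : ℕ} (hs0 : 0 ≤ s) (hm : 1 ≤ m)
    (h0 : ∀ n : ℕ, m ≤ n → ∀ ω, 0 ≤ Ψ ω + (H ω - s) / n)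
    (hs : ∀ᵐ ω ∂μ, s = 1 ∨ 0 < Φ ω)
    (hco : ∀ᵐ ω ∂μ, ∃ ε > 0, ∀ v, H (θ v ω) < 1 → ε ≤ Φ ω + Ψ (θ v ω)) :
    ∫⁻ ω, ENNReal.ofReal (min (H ω) (H (θ (τ ω) ω))) ∂μ ≤ ∫⁻ ω, ENNReal.ofReal (H ω) ∂ν := by
  let D : ℕ → Ω → ℝ := fun k ω =>
    ((k + m : ℕ) : ℝ) * (Φ ω - cTransform θ (fun ω => Ψ ω + (H ω - s) / ((k + m : ℕ) : ℝ)) ω) + s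
  have hpos : ∀ k : ℕ, (0 : ℝ) < ((k + m : ℕ) : ℝ) := fun k => by exact_mod_cast (by omega)
  have hΨ'0 : ∀ (k : ℕ) ω, 0 ≤ Ψ ω + (H ω - s) / ((k + m : ℕ) : ℝ) := fun k ω =>
    h0 (k + m) (by omega) ω
  have hlow : ∀ (k : ℕ) ω (a : ℝ), 0 ≤ Φ ω - (a - s) / ((k + m : ℕ) : ℝ) →
      (∀ v, (a - H (θ v ω)) / ((k + m : ℕ) : ℝ) ≤ Φ ω + Ψ (θ v ω) - Real.exp (-‖v‖)) →
      a ≤ D k ω := by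
    intro k ω a h1 h2
    have h3 : cTransform θ (fun ω => Ψ ω + (H ω - s) / ((k + m : ℕ) : ℝ)) ω ≤
        Φ ω - (a - s) / ((k + m : ℕ) : ℝ) := by
      refine cTransform_le h1 fun v => ?_
      have := h2 v
      simp only [sub_div] at this ⊢
      linarith
    have h4 : (a - s) / ((k + m : ℕ) : ℝ) ≤
        Φ ω - cTransform θ (fun ω => Ψ ω + (H ω - s) / ((k + m : ℕ) : ℝ)) ω := by linarith
    rw [div_le_iff₀ (hpos k)] at h4
    simp only [D]
    linarith
  have hD0 : ∀ k ω, 0 ≤ D k ω := fun k ω => by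
    refine hlow k ω 0 ?_ fun v => ?_
    · have := div_nonneg hs0 (hpos k).le
      rw [zero_sub, neg_div]
      linarith [(hadm.left_mem ω).1]
    · have := div_nonneg (hH01 (θ v ω)).1 (hpos k).le
      rw [zero_sub, neg_div]
      linarith [hadm.le_add ω v]
  have hadm' : ∀ k : ℕ, Admissible θ
      (cTransform θ (fun ω => Ψ ω + (H ω - s) / ((k + m : ℕ) : ℝ))) _ := fun k =>
    admissible_cTransform hθ
      (hadm.measurable_right.add ((hHm.sub_const s).div_const _)) (hΨ'0 k) fun ω =>
      (hadm.right_lipschitz.orbitContinuous hθ ω).add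
        (((hH ω).sub continuous_const).div_const _)
  have hDm : ∀ k, Measurable (D k) := fun k =>
    ((hadm.measurable_left.sub (hadm' k).measurable_left).const_mul _).add_const s
  have hDi : ∀ k, Integrable (D k) μ := fun k =>
    (((integrable_of_mem_Icc hadm.measurable_left hadm.left_mem).sub
      (integrable_of_mem_Icc (hadm' k).measurable_left (hadm' k).left_mem)).const_mul _).add
      (integrable_const s)
  have hint : ∀ k, ∫⁻ ω, ENNReal.ofReal (D k ω) ∂μ ≤ ∫⁻ ω, ENNReal.ofReal (H ω) ∂ν := fun k => by
    rw [← ofReal_integral_eq_lintegral_ofReal (hDi k) (ae_of_all _ (hD0 k)),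
      ← ofReal_integral_eq_lintegral_ofReal (integrable_of_mem_Icc hHm hH01)
        (ae_of_all _ fun ω => (hH01 ω).1)]
    exact ENNReal.ofReal_le_ofReal
      (hadm.integral_perturbation_le hmass hθ hmin hHm hH hH01 (hpos k) (hΨ'0 k))
  have hlim : ∀ᵐ ω ∂μ, ENNReal.ofReal (min (H ω) (H (θ (τ ω) ω))) ≤
      liminf (fun k => ENNReal.ofReal (D k ω)) atTop := by
    filter_upwards [hτ, hs, hco] with ω hτω hsω hcoω
    obtain ⟨ε, hε, hcoω⟩ := hcoω
    refine le_of_forall_lt fun b hb => ?_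
    obtain ⟨c, hbc, hcg⟩ := exists_between hb
    refine hbc.trans_le (le_liminf_of_le (by isBoundedDefault) ?_)
    have hctop : c ≠ ⊤ := (hcg.trans ENNReal.ofReal_lt_top).ne
    lift c to NNReal using hctop
    have hcm : (c : ℝ) < min (H ω) (H (θ (τ ω) ω)) := by
      rw [← ENNReal.ofReal_coe_nnreal] at hcg
      exact (ENNReal.ofReal_lt_ofReal_iff_of_nonneg c.2).1 hcg
    have hc1 : (c : ℝ) < 1 := (hcm.trans_le (min_le_left _ _)).trans_le (hH01 ω).2
    obtain ⟨δ, hδ, hgap⟩ := hadm.exists_pos_le_gap hθ hH hc1 hε (fun v hv => by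
      rcases hτω v hv with rfl | rfl
      · rw [hθ.zero]; exact hcm.trans_le (min_le_left _ _)
      · exact hcm.trans_le (min_le_right _ _)) hcoω
    have htend : Tendsto (fun k : ℕ => (1 : ℝ) / ((k + m : ℕ) : ℝ)) atTop (nhds 0) :=
      (tendsto_add_atTop_iff_nat (f := fun k : ℕ => (1 : ℝ) / (k : ℝ)) m).2
        tendsto_one_div_atTop_nhds_zero_nat
    have hev : ∀ᶠ k : ℕ in atTop, s = 1 ∨ (1 : ℝ) / ((k + m : ℕ) : ℝ) < Φ ω := by
      rcases hsω with h | h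
      · exact Eventually.of_forall fun _ => Or.inl h
      · exact (htend.eventually_lt_const h).mono fun _ => Or.inr
    filter_upwards [htend.eventually_lt_const hδ, hev] with k hk hk'
    rw [← ENNReal.ofReal_coe_nnreal]
    refine ENNReal.ofReal_le_ofReal (hlow k ω c ?_ fun v => ?_)
    · have hΦ0 := (hadm.left_mem ω).1
      rcases hk' with rfl | hk'
      · have := div_nonpos_of_nonpos_of_nonneg (sub_nonpos.2 hc1.le) (hpos k).le
        linarith
      · have : ((c : ℝ) - s) / ((k + m : ℕ) : ℝ) ≤ 1 / ((k + m : ℕ) : ℝ) :=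
          div_le_div_of_nonneg_right (by linarith) (hpos k).le
        linarith
    · rcases le_total (H (θ v ω)) c with h | h
      · have h1 : ((c : ℝ) - H (θ v ω)) / ((k + m : ℕ) : ℝ) ≤ 1 / ((k + m : ℕ) : ℝ) :=
          div_le_div_of_nonneg_right (by linarith [(hH01 (θ v ω)).1]) (hpos k).le
        linarith [hgap v h]
      · have h1 := div_nonpos_of_nonpos_of_nonneg (sub_nonpos.2 h) (hpos k).le
        linarith [hadm.le_add ω v]
  calc ∫⁻ ω, ENNReal.ofReal (min (H ω) (H (θ (τ ω) ω))) ∂μ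
      ≤ ∫⁻ ω, liminf (fun k => ENNReal.ofReal (D k ω)) atTop ∂μ := lintegral_mono_ae hlim
    _ ≤ liminf (fun k => ∫⁻ ω, ENNReal.ofReal (D k ω) ∂μ) atTop :=
      lintegral_liminf_le fun k => (hDm k).ennreal_ofReal
    _ ≤ ∫⁻ ω, ENNReal.ofReal (H ω) ∂ν :=
      liminf_le_of_le (by isBoundedDefault) fun b hb =>
        let ⟨k, hk⟩ := hb.exists
        hk.trans (hint k)

/-- The transport inequality for the contact map of an optimal dual pair. -/
lemma Admissible.lintegral_min_le {μ ν : Measure Ω} [IsFiniteMeasure μ]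
    [IsFiniteMeasure ν] (hmass : μ univ = ν univ) (hadm : Admissible θ Φ Ψ) (hθ : IsFlow θ)
    (hmin : ∀ Φ' Ψ', Admissible θ Φ' Ψ' → dualCost μ ν Φ Ψ ≤ dualCost μ ν Φ' Ψ')
    (hHm : Measurable H) (hH : OrbitContinuous θ H) (hH01 : ∀ ω, H ω ∈ Icc (0 : ℝ) 1)
    {τ : Ω → Eucl d}
    (hτ : ∀ᵐ ω ∂μ, ∀ v, Φ ω + Ψ (θ v ω) = Real.exp (-‖v‖) → v = 0 ∨ v = τ ω)
    (hpos : (∀ᵐ ω ∂μ, 0 < Φ ω) ∨ ∀ᵐ ω ∂ν, 0 < Ψ ω) :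
    ∫⁻ ω, ENNReal.ofReal (min (H ω) (H (θ (τ ω) ω))) ∂μ ≤ ∫⁻ ω, ENNReal.ofReal (H ω) ∂ν := by
  rcases hpos with hpos | hpos
  · refine hadm.lintegral_min_le_of_coercive hmass hθ hmin hHm hH hH01 hτ le_rfl le_rfl
      (fun n _ ω => ?_) (hpos.mono fun _ => Or.inr) (hpos.mono fun ω h => ⟨_, h, fun v _ => ?_⟩)
    · have := div_nonneg (hH01 ω).1 n.cast_nonneg
      rw [sub_zero]
      linarith [(hadm.right_mem ω).1]
    · linarith [(hadm.right_mem (θ v ω)).1]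
  · let χ : ℕ → ℝ → ℝ := fun m t => min 1 (max (m * t - 1) 0)
    have hχc : ∀ m, Continuous (χ m) := fun m => by fun_prop
    have hχ0 : ∀ m t, 0 ≤ χ m t := fun m t => le_min zero_le_one (le_max_right _ _)
    have hχ1 : ∀ m t, χ m t ≤ 1 := fun m t => min_le_left _ _
    let G : ℕ → Ω → ℝ := fun m ω => 1 - (1 - H ω) * χ m (Ψ ω)
    have hGm : ∀ m, Measurable (G m) := fun m => measurable_const.sub
      ((measurable_const.sub hHm).mul ((hχc m).measurable.comp hadm.measurable_right))
    have hGc : ∀ m, OrbitContinuous θ (G m) := fun m ω => continuous_const.sub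
      ((continuous_const.sub (hH ω)).mul
        ((hχc m).comp (hadm.right_lipschitz.orbitContinuous hθ ω)))
    have hHG : ∀ m ω, H ω ≤ G m ω := fun m ω => by
      have h1 := (hH01 ω).2
      have h2 := hχ1 m (Ψ ω)
      simp only [G]
      nlinarith
    have hG01 : ∀ m ω, G m ω ∈ Icc (0 : ℝ) 1 := fun m ω =>
      ⟨(hH01 ω).1.trans (hHG m ω), sub_le_self _ (mul_nonneg (by linarith [(hH01 ω).2]) (hχ0 _ _))⟩
    have hGΨ : ∀ m : ℕ, 1 ≤ m → ∀ ω, G m ω < 1 → (1 : ℝ) / m ≤ Ψ ω := fun m hm ω hlt => by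
      by_contra! hΨ
      have hm' : (0 : ℝ) < m := by exact_mod_cast hm
      rw [lt_div_iff₀ hm'] at hΨ
      have : χ m (Ψ ω) = 0 := by
        simp only [χ]
        rw [max_eq_right (by linarith), min_eq_right zero_le_one]
      simp only [G, this] at hlt
      linarith
    have hstep : ∀ m : ℕ, 1 ≤ m → ∫⁻ ω, ENNReal.ofReal (min (H ω) (H (θ (τ ω) ω))) ∂μ ≤
        ∫⁻ ω, ENNReal.ofReal (G m ω) ∂ν := fun m hm => by
      refine le_trans (lintegral_mono fun ω => ENNReal.ofReal_le_ofReal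
        (min_le_min (hHG m _) (hHG m _))) <|
        hadm.lintegral_min_le_of_coercive hmass hθ hmin (hGm m) (hGc m) (hG01 m) hτ zero_le_one hm
          (fun n hn ω => ?_) (ae_of_all _ fun _ => Or.inl rfl)
          (ae_of_all _ fun ω => ⟨1 / m, by positivity, fun v hv => ?_⟩)
      · have hn' : (0 : ℝ) < n := by exact_mod_cast (hm.trans hn)
        rcases (hG01 m ω).2.lt_or_eq with h | h
        · have h1 := hGΨ m hm ω h
          have h2 : (1 : ℝ) / n ≤ 1 / m :=
            one_div_le_one_div_of_le (by exact_mod_cast hm) (by exact_mod_cast hn)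
          have h3 : -(1 / (n : ℝ)) ≤ (G m ω - 1) / n := by
            rw [← neg_div]
            exact div_le_div_of_nonneg_right (by linarith [(hG01 m ω).1]) hn'.le
          linarith
        · rw [h, sub_self, zero_div, add_zero]
          exact (hadm.right_mem ω).1
      · linarith [hGΨ m hm _ hv, (hadm.left_mem ω).1]
    have hlim : Tendsto (fun m => ∫⁻ ω, ENNReal.ofReal (G m ω) ∂ν) atTop
        (nhds (∫⁻ ω, ENNReal.ofReal (H ω) ∂ν)) := by
      refine tendsto_lintegral_of_dominated_convergence (fun _ => 1)
        (fun m => (hGm m).ennreal_ofReal) (fun m => ae_of_all _ fun ω => ?_) (by simp) ?_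
      · exact (ENNReal.ofReal_le_ofReal (hG01 m ω).2).trans ENNReal.ofReal_one.le
      · filter_upwards [hpos] with ω hω
        refine tendsto_const_nhds.congr' ?_
        obtain ⟨M, hM⟩ := exists_nat_ge (2 / Ψ ω)
        filter_upwards [eventually_ge_atTop M] with m hm
        have h1 : 2 / Ψ ω ≤ m := hM.trans (by exact_mod_cast hm)
        rw [div_le_iff₀ hω] at h1
        have : χ m (Ψ ω) = 1 := by
          simp only [χ]
          rw [min_eq_left (le_max_of_le_left (by linarith))]
        simp only [G, this]
        congr 1
        ring
    exact ge_of_tendsto hlim (eventually_atTop.2 ⟨1, hstep⟩)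

end Perturbation

section Selection

/-- Closed balls of radius `1 / (m + 1)` around a dense sequence form a countable neighbourhood
system. -/
lemma exists_closedBall_denseSeq_subset {E : Type*} [PseudoMetricSpace E]
    [TopologicalSpace.SeparableSpace E] [Nonempty E] {O : Set E} (hO : IsOpen O) {v : E}
    (hv : v ∈ O) :
    ∃ n m : ℕ, v ∈ Metric.closedBall (TopologicalSpace.denseSeq E n) (1 / (m + 1)) ∧
      Metric.closedBall (TopologicalSpace.denseSeq E n) (1 / (m + 1)) ⊆ O := by
  obtain ⟨ε, hε, hball⟩ := Metric.isOpen_iff.1 hO v hv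
  obtain ⟨m, hm⟩ := exists_nat_one_div_lt (half_pos hε)
  obtain ⟨n, hn⟩ := (TopologicalSpace.denseRange_denseSeq E).exists_dist_lt v
    (Nat.one_div_pos_of_nat (α := ℝ) (n := m))
  refine ⟨n, m, Metric.mem_closedBall.2 hn.le, fun w hw => hball ?_⟩
  rw [Metric.mem_closedBall] at hw
  rw [Metric.mem_ball]
  calc dist w v ≤ dist w (TopologicalSpace.denseSeq E n) + dist v (TopologicalSpace.denseSeq E n) :=
        dist_triangle_right _ _ _
    _ < ε := by linarith

/-- A measurable set-valued map with values in the complement of a point admits a measurable map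
selecting the unique element wherever the value is a singleton. -/
lemma exists_measurable_eq_of_subsingleton {E : Type*} [MetricSpace E] [ProperSpace E]
    [TopologicalSpace.SeparableSpace E] [MeasurableSpace E] [BorelSpace E] (e : E)
    {N : Ω → Set E} (he : ∀ ω, e ∉ N ω)
    (hN : ∀ K, IsCompact K → e ∉ K → MeasurableSet {ω | (N ω ∩ K).Nonempty}) :
    MeasurableSet {ω | (N ω).Subsingleton} ∧
      ∃ τ : Ω → E, Measurable τ ∧ ∀ ω, (N ω).Subsingleton → ∀ v ∈ N ω, v = τ ω := by
  have : Nonempty E := ⟨e⟩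
  let K : ℕ × ℕ → Set E := fun i =>
    Metric.closedBall (TopologicalSpace.denseSeq E i.1) (1 / (i.2 + 1))
  have hKc : ∀ i, IsCompact (K i) := fun i => isCompact_closedBall _ _
  have hK : ∀ {O : Set E}, IsOpen O → ∀ {v}, v ∈ O → ∃ i, v ∈ K i ∧ K i ⊆ O := fun hO v hv =>
    let ⟨n, m, h⟩ := exists_closedBall_denseSeq_subset hO hv
    ⟨(n, m), h⟩
  have hopen : ∀ {O : Set E}, IsOpen O → MeasurableSet {ω | (N ω ∩ O).Nonempty} := fun {O} hO => by
    have : {ω | (N ω ∩ O).Nonempty} =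
        ⋃ i ∈ {i | K i ⊆ O \ {e}}, {ω | (N ω ∩ K i).Nonempty} := by
      ext ω
      simp only [mem_iUnion, mem_ofPred_eq, exists_prop]
      refine ⟨fun ⟨v, hv, hvO⟩ => ?_, fun ⟨i, hi, v, hv, hvi⟩ => ⟨v, hv, (hi hvi).1⟩⟩
      obtain ⟨i, hi, hiO⟩ := hK (hO.sdiff isClosed_singleton)
        (show v ∈ O \ {e} from ⟨hvO, fun h => he ω (h ▸ hv)⟩)
      exact ⟨i, hiO, v, hv, hi⟩
    rw [this]
    exact MeasurableSet.biUnion (to_countable _) fun i hi =>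
      hN _ (hKc i) fun h => (hi h).2 rfl
  have hU : MeasurableSet {ω | (N ω).Subsingleton} := by
    have : {ω | (N ω).Subsingleton}ᶜ = ⋃ i ∈ {i | e ∉ K i}, {ω | (N ω ∩ K i).Nonempty} ∩
        {ω | (N ω ∩ (K i)ᶜ).Nonempty} := by
      ext ω
      simp only [mem_compl_iff, mem_ofPred_eq, mem_iUnion, mem_inter_iff, Set.Subsingleton]
      push Not
      constructor
      · rintro ⟨v, hv, w, hw, hvw⟩
        obtain ⟨i, hvi, hi⟩ := hK ((isOpen_compl_singleton (x := w)).inter (isOpen_compl_singleton (x := e)))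
          (v := v) ⟨hvw, fun h => he ω (h ▸ hv)⟩
        exact ⟨i, fun h => (hi h).2 rfl, ⟨v, hv, hvi⟩, w, hw, fun h => (hi h).1 rfl⟩
      · rintro ⟨i, -, ⟨v, hv, hvi⟩, w, hw, hwi⟩
        exact ⟨v, hv, w, hw, fun h => hwi (h ▸ hvi)⟩
    rw [← MeasurableSet.compl_iff, this]
    exact MeasurableSet.biUnion (to_countable _) fun i hi =>
      (hN _ (hKc i) hi).inter (hopen Metric.isClosed_closedBall.isOpen_compl)
  have hV : MeasurableSet {ω | (N ω).Subsingleton ∧ (N ω).Nonempty} := by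
    have := hopen isOpen_univ
    simp only [inter_univ] at this
    exact hU.inter this
  have hτ : ∀ ω, ∃ v, ((N ω).Subsingleton ∧ (N ω).Nonempty → v ∈ N ω) ∧
      (¬((N ω).Subsingleton ∧ (N ω).Nonempty) → v = e) := fun ω => by
    by_cases h : (N ω).Subsingleton ∧ (N ω).Nonempty
    · exact ⟨h.2.some, fun _ => h.2.some_mem, fun h' => absurd h h'⟩
    · exact ⟨e, fun h' => absurd h' h, fun _ => rfl⟩
  choose τ hτ hτe using hτ
  refine ⟨hU, τ, measurable_of_isOpen fun O hO => ?_, fun ω h v hv => h hv (hτ ω ⟨h, v, hv⟩)⟩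
  have : τ ⁻¹' O = ({ω | (N ω).Subsingleton ∧ (N ω).Nonempty} ∩ {ω | (N ω ∩ O).Nonempty}) ∪
      ({ω | (N ω).Subsingleton ∧ (N ω).Nonempty}ᶜ ∩ {_ω | e ∈ O}) := by
    ext ω
    by_cases h : (N ω).Subsingleton ∧ (N ω).Nonempty
    · have : τ ω ∈ O ↔ (N ω ∩ O).Nonempty :=
        ⟨fun hO => ⟨_, hτ ω h, hO⟩, fun ⟨v, hv, hvO⟩ => h.1 hv (hτ ω h) ▸ hvO⟩
      simp only [mem_preimage, mem_union, mem_inter_iff, mem_compl_iff, mem_ofPred_eq, this]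
      tauto
    · simp only [mem_preimage, mem_union, mem_inter_iff, mem_compl_iff, mem_ofPred_eq, hτe ω h]
      tauto
  rw [this]
  exact (hV.inter (hopen hO)).union (hV.compl.inter (MeasurableSet.const _))

variable {d : ℕ} {θ : Eucl d → Ω → Ω} {Φ Ψ : Ω → ℝ}

/-- The nonzero displacements at which the dual constraint is tight. -/
def contactSet (θ : Eucl d → Ω → Ω) (Φ Ψ : Ω → ℝ) (ω : Ω) : Set (Eucl d) :=
  {v | v ≠ 0 ∧ Φ ω + Ψ (θ v ω) = Real.exp (-‖v‖)}

lemma Admissible.measurableSet_contactSet_inter (hadm : Admissible θ Φ Ψ) (hθ : IsFlow θ)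
    {K : Set (Eucl d)} (hK : IsCompact K) (h0 : 0 ∉ K) :
    MeasurableSet {ω | (contactSet θ Φ Ψ ω ∩ K).Nonempty} := by
  obtain ⟨s, hsK, hs, hKs⟩ := (TopologicalSpace.IsSeparable.of_separableSpace K).exists_countable_dense_subset
  have hf : ∀ ω, Continuous fun v : Eucl d => Φ ω + Ψ (θ v ω) - Real.exp (-‖v‖) := fun ω =>
    (continuous_const.add (hadm.right_lipschitz.orbitContinuous hθ ω)).sub
      (Real.continuous_exp.comp continuous_norm.neg)
  have : {ω | (contactSet θ Φ Ψ ω ∩ K).Nonempty} = ⋂ n : ℕ, ⋃ v ∈ s,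
      {ω | Φ ω + Ψ (θ v ω) - Real.exp (-‖v‖) < 1 / (n + 1)} := by
    ext ω
    simp only [mem_iInter, mem_iUnion, mem_ofPred_eq, exists_prop]
    constructor
    · rintro ⟨v, ⟨-, hv⟩, hvK⟩ n
      have hvs := hKs hvK
      rw [mem_closure_iff] at hvs
      obtain ⟨w, hw, hws⟩ := hvs _ ((isOpen_Iio (a := (1 : ℝ) / (n + 1))).preimage (hf ω))
        (by simp only [mem_preimage, mem_Iio, hv, sub_self]; positivity)
      exact ⟨w, hws, hw⟩
    · intro h
      have hne : K.Nonempty := let ⟨v, hv, _⟩ := h 0; ⟨v, hsK hv⟩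
      obtain ⟨v, hvK, hmin⟩ := hK.exists_isMinOn hne (hf ω).continuousOn
      refine ⟨v, ⟨fun hv => h0 (hv ▸ hvK), ?_⟩, hvK⟩
      have hle : Φ ω + Ψ (θ v ω) - Real.exp (-‖v‖) ≤ 0 := by
        refine le_of_forall_pos_le_add fun ε hε => ?_
        obtain ⟨n, hn⟩ := exists_nat_one_div_lt hε
        obtain ⟨w, hw, hwn⟩ := h n
        have := hmin (hsK hw)
        simp only [mem_ofPred_eq] at this
        linarith
      linarith [hadm.le_add ω v]
  rw [this]
  exact MeasurableSet.iInter fun n => MeasurableSet.biUnion hs fun v _ => measurableSet_lt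
    ((hadm.measurable_left.add (hadm.measurable_right.comp (hθ.measurable v))).sub_const _)
    measurable_const

end Selection

section Palm

open ProbabilityTheory (Kernel IsSFiniteKernel)

variable {d : ℕ} {θ : Eucl d → Ω → Ω}

lemma measurableSet_unitCube (d : ℕ) : MeasurableSet (unitCube d) := by
  have : unitCube d = ⋂ i, (fun x : Eucl d => x i) ⁻¹' Ico 0 1 := by
    ext x; simp [unitCube]
  rw [this]
  exact MeasurableSet.iInter fun i => measurableSet_Ico.preimage (by fun_prop)

lemma volume_unitCube (d : ℕ) : volume (unitCube d) = 1 := by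
  have : unitCube d = (MeasurableEquiv.toLp 2 (Fin d → ℝ)).symm ⁻¹' (univ.pi fun _ => Ico (0 : ℝ) 1) := by
    ext x; simp [unitCube]
  rw [this, (EuclideanSpace.volume_preserving_symm_measurableEquiv_toLp (Fin d)).measure_preimage
    (MeasurableSet.univ_pi fun _ => measurableSet_Ico).nullMeasurableSet, Real.volume_pi_Ico]
  simp

/-- Equivariance of a random measure under the flow. -/
def Equivariant (θ : Eucl d → Ω → Ω) (κ : Kernel Ω (Eucl d)) : Prop :=
  ∀ ω x, κ (θ x ω) = (κ ω).map fun y => y - x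

lemma Equivariant.lintegral_eq {κ : Kernel Ω (Eucl d)} (hκ : Equivariant θ κ) (ω : Ω) (x : Eucl d)
    {f : Eucl d → ENNReal} (hf : Measurable f) :
    ∫⁻ y, f y ∂κ (θ x ω) = ∫⁻ y, f (y - x) ∂κ ω := by
  rw [hκ, lintegral_map hf (measurable_sub_const x)]

/-- The Palm measure of an equivariant random measure. -/
def palm (P : Measure Ω) (θ : Eucl d → Ω → Ω) (κ : Kernel Ω (Eucl d)) : Measure Ω :=
  ((P.compProd κ).restrict (univ ×ˢ unitCube d)).map fun p => θ p.2 p.1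

lemma IsFlow.measurable_swap (hθ : IsFlow θ) : Measurable fun p : Ω × Eucl d => θ p.2 p.1 :=
  hθ.measurable_uncurry.comp _root_.measurable_swap

lemma ae_palm_of_ae_ae {P : Measure Ω} {κ : Kernel Ω (Eucl d)} (hθ : IsFlow θ) {B : Set Ω} (hB : MeasurableSet B)
    (h : ∀ᵐ ω ∂P, ∀ᵐ x ∂κ ω, θ x ω ∈ B) : ∀ᵐ ω ∂palm P θ κ, ω ∈ B := by
  refine (ae_map_iff hθ.measurable_swap.aemeasurable hB).2 ?_
  exact ae_restrict_of_ae (Measure.ae_compProd_of_ae_ae (hθ.measurable_swap hB) h)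

variable {P : Measure Ω} [SFinite P] {κ : Kernel Ω (Eucl d)} [IsSFiniteKernel κ]

lemma lintegral_palm (hθ : IsFlow θ) {f : Ω → ENNReal} (hf : Measurable f) :
    ∫⁻ ω, f ω ∂palm P θ κ = ∫⁻ ω, ∫⁻ x in unitCube d, f (θ x ω) ∂κ ω ∂P := by
  rw [palm, lintegral_map hf hθ.measurable_swap,
    Measure.setLIntegral_compProd (f := fun p : Ω × Eucl d => f (θ p.2 p.1))
      (hf.comp hθ.measurable_swap) MeasurableSet.univ (measurableSet_unitCube d),
    Measure.restrict_univ]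

lemma palm_univ (hθ : IsFlow θ) : palm P θ κ univ = ∫⁻ ω, κ ω (unitCube d) ∂P := by
  rw [← lintegral_one, lintegral_palm hθ measurable_const]
  simp

/-- The refined Campbell formula. -/
lemma lintegral_palm_lintegral (hθ : IsFlow θ) (hstat : ∀ x, MeasurePreserving (θ x) P P)
    (hκ : Equivariant θ κ) {F : Ω → Eucl d → ENNReal} (hF : Measurable (Function.uncurry F)) :
    ∫⁻ ω, ∫⁻ z : Eucl d, F (θ (-z) ω) z ∂volume ∂palm P θ κ = ∫⁻ ω, ∫⁻ x, F ω x ∂κ ω ∂P := by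
  have hc := measurableSet_unitCube d
  obtain ⟨g, hgdef⟩ : ∃ g : Eucl d → ENNReal, g = (unitCube d).indicator 1 := ⟨_, rfl⟩
  have hg : Measurable g := hgdef ▸ measurable_one.indicator hc
  have hFc : Measurable fun p : (Ω × Eucl d) × Eucl d => F (θ p.1.2 p.1.1) p.2 :=
    hF.comp ((hθ.measurable_swap.comp measurable_fst).prodMk measurable_snd)
  have hm1 : Measurable fun p : (Ω × Eucl d) × Eucl d => g p.2 * F (θ p.1.2 p.1.1) (p.2 - p.1.2) :=
    (hg.comp measurable_snd).mul (hFc.comp (measurable_fst.prodMk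
      (measurable_snd.sub (measurable_snd.comp measurable_fst))))
  have hm2 : Measurable fun p : (Ω × Eucl d) × Eucl d => g (p.2 + p.1.2) * F p.1.1 p.2 :=
    (hg.comp (measurable_snd.add (measurable_snd.comp measurable_fst))).mul
      (hF.comp ((measurable_fst.comp measurable_fst).prodMk measurable_snd))
  have hpar : ∀ {f : (Ω × Eucl d) × Eucl d → ENNReal}, Measurable f →
      Measurable fun q : Ω × Eucl d => ∫⁻ x, f (q, x) ∂κ q.1 := fun hf =>
    Measurable.lintegral_kernel_prod_right (κ := κ.comap Prod.fst measurable_fst) hf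
  have step1 : ∀ ω, ∫⁻ x in unitCube d, ∫⁻ z : Eucl d, F (θ (-z) (θ x ω)) z ∂volume ∂κ ω =
      ∫⁻ w : Eucl d, ∫⁻ x, g x * F (θ w ω) (x - w) ∂κ ω := fun ω => by
    have h1 : ∀ x : Eucl d, ∫⁻ z : Eucl d, F (θ (-z) (θ x ω)) z =
        ∫⁻ w : Eucl d, F (θ w ω) (x - w) := fun x => by
      rw [← lintegral_sub_left_eq_self _ x]
      refine lintegral_congr fun w => ?_
      rw [hθ.add]
      congr 2
      abel
    have h2 : ∀ x, (unitCube d).indicator (fun x => ∫⁻ w, F (θ w ω) (x - w)) x =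
        ∫⁻ w, g x * F (θ w ω) (x - w) := fun x => by
      by_cases hx : x ∈ unitCube d <;> simp [hgdef, hx]
    simp only [h1]
    rw [← lintegral_indicator hc, lintegral_congr h2, lintegral_lintegral_swap]
    exact (hm1.comp ((measurable_const.prodMk measurable_snd).prodMk measurable_fst)).aemeasurable
  have step2 : ∀ w, ∫⁻ ω, ∫⁻ x, g x * F (θ w ω) (x - w) ∂κ ω ∂P =
      ∫⁻ ω, ∫⁻ y, g (y + w) * F ω y ∂κ ω ∂P := fun w => by
    have hm : Measurable fun ω => ∫⁻ y, g (y + w) * F ω y ∂κ ω :=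
      (hpar hm2).comp (measurable_id.prodMk measurable_const)
    rw [← (hstat w).lintegral_comp hm]
    refine lintegral_congr fun ω => ?_
    rw [hκ.lintegral_eq ω w (f := fun y => g (y + w) * F (θ w ω) y)
      (hm2.comp ((measurable_const (a := (θ w ω, w))).prodMk measurable_id))]
    simp only [sub_add_cancel]
  have step3 : ∀ ω y, ∫⁻ w, g (y + w) * F ω y = F ω y := fun ω y => by
    rw [lintegral_mul_const (f := fun w => g (y + w)) _ (hg.comp (measurable_const_add y)),
      lintegral_add_left_eq_self g y, hgdef, lintegral_indicator_one hc,
      volume_unitCube, one_mul]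
  have hm0 : Measurable fun ω => ∫⁻ z : Eucl d, F (θ (-z) ω) z :=
    Measurable.lintegral_prod_right' (f := fun q : Ω × Eucl d => F (θ (-q.2) q.1) q.2)
      (hFc.comp ((measurable_fst.prodMk measurable_snd.neg).prodMk measurable_snd))
  calc ∫⁻ ω, ∫⁻ z : Eucl d, F (θ (-z) ω) z ∂volume ∂palm P θ κ
      = ∫⁻ ω, ∫⁻ w : Eucl d, ∫⁻ x, g x * F (θ w ω) (x - w) ∂κ ω ∂volume ∂P := by
        rw [lintegral_palm hθ hm0, lintegral_congr step1]
    _ = ∫⁻ w : Eucl d, ∫⁻ ω, ∫⁻ x, g x * F (θ w ω) (x - w) ∂κ ω ∂P :=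
        lintegral_lintegral_swap (hpar hm1).aemeasurable
    _ = ∫⁻ w : Eucl d, ∫⁻ ω, ∫⁻ y, g (y + w) * F ω y ∂κ ω ∂P := lintegral_congr step2
    _ = ∫⁻ ω, ∫⁻ w : Eucl d, ∫⁻ y, g (y + w) * F ω y ∂κ ω ∂volume ∂P :=
        (lintegral_lintegral_swap (hpar hm2).aemeasurable).symm
    _ = ∫⁻ ω, ∫⁻ x, F ω x ∂κ ω ∂P := by
        refine lintegral_congr fun ω => ?_
        rw [lintegral_lintegral_swap]
        · exact lintegral_congr (step3 ω)
        · exact (hm2.comp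
            ((measurable_const.prodMk measurable_fst).prodMk measurable_snd)).aemeasurable

end Palm

section Approximation

open ProbabilityTheory (Kernel)

variable {d : ℕ} {θ : Eucl d → Ω → Ω} {ν : Measure Ω}

/-- A measurable set which is approximable in `L¹` by functions that are continuous along the
orbits of the flow. -/
def OrbitApproximable (θ : Eucl d → Ω → Ω) (ν : Measure Ω) (B : Set Ω) : Prop :=
  MeasurableSet B ∧ ∀ ε : ENNReal, ε ≠ 0 → ∃ H : Ω → ℝ, Measurable H ∧ OrbitContinuous θ H ∧
    (∀ ω, H ω ∈ Icc (0 : ℝ) 1) ∧ ∫⁻ ω, ENNReal.ofReal |B.indicator 1 ω - H ω| ∂ν ≤ ε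

lemma OrbitApproximable.empty : OrbitApproximable θ ν ∅ :=
  ⟨MeasurableSet.empty, fun ε _ => ⟨fun _ => 0, measurable_const, fun _ => continuous_const,
    fun _ => ⟨le_rfl, zero_le_one⟩, by simp⟩⟩

lemma OrbitApproximable.compl {B : Set Ω} (h : OrbitApproximable θ ν B) :
    OrbitApproximable θ ν Bᶜ := by
  refine ⟨h.1.compl, fun ε hε => ?_⟩
  obtain ⟨H, hm, hc, h01, hH⟩ := h.2 ε hε
  refine ⟨fun ω => 1 - H ω, measurable_const.sub hm, fun ω => continuous_const.sub (hc ω),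
    fun ω => ⟨by linarith [(h01 ω).2], by linarith [(h01 ω).1]⟩, ?_⟩
  refine (lintegral_congr fun ω => ?_).trans_le hH
  congr 1
  by_cases hω : ω ∈ B
  · simp only [indicator_of_notMem (notMem_compl_iff.2 hω), indicator_of_mem hω, Pi.one_apply]
    rw [zero_sub, abs_neg]
  · simp only [indicator_of_mem (mem_compl hω), indicator_of_notMem hω, Pi.one_apply]
    rw [zero_sub, abs_neg]
    congr 1
    ring

lemma OrbitApproximable.union {B C : Set Ω} (hB : OrbitApproximable θ ν B)
    (hC : OrbitApproximable θ ν C) : OrbitApproximable θ ν (B ∪ C) := by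
  refine ⟨hB.1.union hC.1, fun ε hε => ?_⟩
  obtain ⟨H, hm, hc, h01, hH⟩ := hB.2 (ε / 2) (by simpa using hε)
  obtain ⟨K, km, kc, k01, hK⟩ := hC.2 (ε / 2) (by simpa using hε)
  refine ⟨fun ω => max (H ω) (K ω), hm.max km, fun ω => (hc ω).max (kc ω),
    fun ω => ⟨le_max_of_le_left (h01 ω).1, max_le (h01 ω).2 (k01 ω).2⟩, ?_⟩
  calc ∫⁻ ω, ENNReal.ofReal |(B ∪ C).indicator 1 ω - max (H ω) (K ω)| ∂ν
      ≤ ∫⁻ ω, (ENNReal.ofReal |B.indicator 1 ω - H ω| +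
          ENNReal.ofReal |C.indicator 1 ω - K ω|) ∂ν := by
        refine lintegral_mono fun ω => ?_
        rw [← ENNReal.ofReal_add (abs_nonneg _) (abs_nonneg _)]
        refine ENNReal.ofReal_le_ofReal ?_
        have h1 : (B ∪ C).indicator (1 : Ω → ℝ) ω = max (B.indicator 1 ω) (C.indicator 1 ω) := by
          by_cases hω : ω ∈ B <;> by_cases hω' : ω ∈ C <;> simp [hω, hω']
        rw [h1]
        exact (abs_max_sub_max_le_max _ _ _ _).trans
          (max_le_add_of_nonneg (abs_nonneg _) (abs_nonneg _))
    _ = ∫⁻ ω, ENNReal.ofReal |B.indicator 1 ω - H ω| ∂ν +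
          ∫⁻ ω, ENNReal.ofReal |C.indicator 1 ω - K ω| ∂ν :=
        lintegral_add_left (((measurable_one.indicator hB.1).sub hm).abs.ennreal_ofReal) _
    _ ≤ ε / 2 + ε / 2 := add_le_add hH hK
    _ = ε := ENNReal.add_halves ε

lemma OrbitApproximable.iUnion [IsFiniteMeasure ν] {f : ℕ → Set Ω}
    (h : ∀ n, OrbitApproximable θ ν (f n)) : OrbitApproximable θ ν (⋃ n, f n) := by
  have hacc : ∀ n, OrbitApproximable θ ν (accumulate f n) := fun n => by
    induction n with
    | zero => simpa using h 0
    | succ n ih => simpa [accumulate_succ] using ih.union (h (n + 1))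
  have hU : MeasurableSet (⋃ n, f n) := MeasurableSet.iUnion fun n => (h n).1
  refine ⟨hU, fun ε hε => ?_⟩
  have hsub : ∀ n, accumulate f n ⊆ ⋃ n, f n := accumulate_subset_iUnion
  have htend : Tendsto (fun n => ν (⋃ n, f n) - ν (accumulate f n)) atTop (nhds 0) := by
    have := ENNReal.Tendsto.sub (tendsto_const_nhds (x := ν (⋃ n, f n)))
      (tendsto_measure_iUnion_accumulate (μ := ν) (f := f)) (Or.inl (measure_ne_top _ _))
    rwa [tsub_self] at this
  obtain ⟨n, hn⟩ := (htend.eventually_lt_const (ENNReal.half_pos hε)).exists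
  obtain ⟨H, hm, hc, h01, hH⟩ := (hacc n).2 (ε / 2) (by simpa using hε)
  refine ⟨H, hm, hc, h01, ?_⟩
  calc ∫⁻ ω, ENNReal.ofReal |(⋃ n, f n).indicator 1 ω - H ω| ∂ν
      ≤ ∫⁻ ω, (((⋃ n, f n) \ accumulate f n).indicator 1 ω +
          ENNReal.ofReal |(accumulate f n).indicator 1 ω - H ω|) ∂ν := by
        refine lintegral_mono fun ω => ?_
        by_cases h1 : ω ∈ accumulate f n
        · simp [h1, hsub n h1]
        · by_cases h2 : ω ∈ ⋃ n, f n
          · rw [indicator_of_mem h2, indicator_of_mem (show ω ∈ (⋃ n, f n) \ accumulate f n from ⟨h2, h1⟩)]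
            refine le_add_right ?_
            simp only [Pi.one_apply, ENNReal.ofReal_le_one]
            exact abs_le.2 ⟨by linarith [(h01 ω).2], by linarith [(h01 ω).1]⟩
          · rw [indicator_of_notMem h2, indicator_of_notMem h1]
            exact le_add_left le_rfl
    _ = ν ((⋃ n, f n) \ accumulate f n) +
          ∫⁻ ω, ENNReal.ofReal |(accumulate f n).indicator 1 ω - H ω| ∂ν := by
        rw [lintegral_add_left (measurable_one.indicator (hU.diff (hacc n).1)),
          lintegral_indicator_one (hU.diff (hacc n).1)]
    _ ≤ ε / 2 + ε / 2 := by
        rw [measure_sdiff (hsub n) (hacc n).1.nullMeasurableSet (measure_ne_top _ _)]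
        exact add_le_add hn.le hH
    _ = ε := ENNReal.add_halves ε

/-- The σ-algebra of sets approximable by functions that are continuous along orbits. -/
@[reducible]
def approximableSigma (θ : Eucl d → Ω → Ω) (ν : Measure Ω) [IsFiniteMeasure ν] :
    MeasurableSpace Ω where
  MeasurableSet' := OrbitApproximable θ ν
  measurableSet_empty := OrbitApproximable.empty
  measurableSet_compl _ := OrbitApproximable.compl
  measurableSet_iUnion _ := OrbitApproximable.iUnion

lemma measurable_approximableSigma [IsFiniteMeasure ν] {L : Ω → ℝ} (hL : Measurable L)
    (hc : OrbitContinuous θ L) : Measurable[approximableSigma θ ν] L := by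
  refine @measurable_of_Ioi ℝ Ω _ _ _ (approximableSigma θ ν) _ _ _ _ fun t => ?_
  have hB : MeasurableSet (L ⁻¹' Ioi t) := measurableSet_Ioi.preimage hL
  refine ⟨hB, fun ε hε => ?_⟩
  obtain ⟨H, hH⟩ : ∃ H : ℕ → Ω → ℝ, ∀ n ω, H n ω = min 1 (n * max (L ω - t) 0) :=
    ⟨fun n ω => min 1 (n * max (L ω - t) 0), fun _ _ => rfl⟩
  have hHm : ∀ n, Measurable (H n) := fun n => by
    rw [show H n = fun ω => min 1 (n * max (L ω - t) 0) from funext (hH n)]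
    fun_prop
  have hH01 : ∀ n ω, H n ω ∈ Icc (0 : ℝ) 1 := fun n ω => by
    rw [hH]
    exact ⟨le_min zero_le_one (mul_nonneg n.cast_nonneg (le_max_right _ _)), min_le_left _ _⟩
  have hlim : ∀ ω, Tendsto (fun n => ENNReal.ofReal |(L ⁻¹' Ioi t).indicator 1 ω - H n ω|) atTop
      (nhds 0) := fun ω => by
    refine tendsto_const_nhds.congr' ?_
    by_cases hω : t < L ω
    · obtain ⟨N, hN⟩ := exists_nat_ge (1 / (L ω - t))
      filter_upwards [eventually_ge_atTop N] with n hn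
      have hpos : 0 < L ω - t := sub_pos.2 hω
      have h1 : 1 ≤ n * (L ω - t) := by
        rw [← div_le_iff₀ hpos]
        exact hN.trans (Nat.cast_le.2 hn)
      rw [hH, max_eq_left hpos.le, min_eq_left h1,
        indicator_of_mem (show ω ∈ L ⁻¹' Ioi t from hω)]
      simp
    · filter_upwards with n
      rw [hH, max_eq_right (by linarith), indicator_of_notMem (show ω ∉ L ⁻¹' Ioi t from hω)]
      simp
  have htend := tendsto_lintegral_of_dominated_convergence (μ := ν) (fun _ => 1)
    (fun n => ((measurable_one.indicator hB).sub (hHm n)).abs.ennreal_ofReal)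
    (fun n => ae_of_all _ fun ω => by
      have := hH01 n ω
      simp only [ENNReal.ofReal_le_one, Pi.sub_apply]
      by_cases hω : ω ∈ L ⁻¹' Ioi t
      · rw [indicator_of_mem hω, Pi.one_apply]
        exact abs_le.2 ⟨by linarith [this.2], by linarith [this.1]⟩
      · rw [indicator_of_notMem hω]
        exact abs_le.2 ⟨by linarith [this.2], by linarith [this.1]⟩)
    (by simp) (ae_of_all _ hlim)
  rw [lintegral_zero] at htend
  obtain ⟨n, hn⟩ := (htend.eventually_lt_const (pos_iff_ne_zero.2 hε)).exists
  refine ⟨H n, hHm n, fun ω => ?_, hH01 n, hn.le⟩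
  simp only [hH]
  exact continuous_const.min (continuous_const.mul (((hc ω).sub continuous_const).max continuous_const))

/-- A locally finite random measure is measurable as soon as its values on compact sets are. -/
lemma measurable_of_measurable_isCompact {κ : Ω → Measure (Eucl d)}
    [∀ ω, IsLocallyFiniteMeasure (κ ω)] (h : ∀ K, IsCompact K → Measurable fun ω => κ ω K) :
    Measurable κ := by
  have hfin : ∀ (n : ℕ) ω, IsFiniteMeasure ((κ ω).restrict (Metric.closedBall 0 n)) := fun n ω =>
    ⟨by rw [Measure.restrict_apply_univ]; exact (isCompact_closedBall _ _).measure_lt_top⟩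
  have hn : ∀ n : ℕ, Measurable fun ω => (κ ω).restrict (Metric.closedBall 0 n) := fun n => by
    have := hfin n
    refine Measurable.measure_of_isPiSystem ((BorelSpace.measurable_eq (α := Eucl d)).trans borel_eq_generateFrom_isClosed)
      isPiSystem_isClosed (fun s hs => ?_) ?_
    · have hs : IsClosed s := hs
      simp only [Measure.restrict_apply hs.measurableSet, inter_comm s]
      exact h _ ((isCompact_closedBall _ _).inter_right hs)
    · simp only [Measure.restrict_apply_univ]
      exact h _ (isCompact_closedBall _ _)
  refine Measure.measurable_of_measurable_coe _ fun s hs => ?_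
  have : (fun ω => κ ω s) = fun ω => ⨆ n : ℕ, (κ ω).restrict (Metric.closedBall 0 n) s := by
    funext ω
    have hU : s = ⋃ n : ℕ, s ∩ Metric.closedBall 0 n := by
      rw [← inter_iUnion, Metric.iUnion_closedBall_nat, inter_univ]
    have hmono : Monotone fun n : ℕ => s ∩ Metric.closedBall (0 : Eucl d) n := fun m n hmn =>
      inter_subset_inter_right _ (Metric.closedBall_subset_closedBall (Nat.cast_le.2 hmn))
    simp only [Measure.restrict_apply hs]
    rw [← hmono.measure_iUnion, ← hU]
  rw [this]
  exact Measurable.iSup fun n => (Measure.measurable_coe hs).comp (hn n)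

lemma orbitContinuous_integral {κ : Kernel Ω (Eucl d)} [∀ ω, IsLocallyFiniteMeasure (κ ω)]
    (hκ : Equivariant θ κ) {f : Eucl d → ℝ} (hf : Continuous f) (hfc : HasCompactSupport f) :
    OrbitContinuous θ fun ω => ∫ y, f y ∂κ ω := by
  intro ω
  have h1 : (fun x => ∫ y, f y ∂κ (θ x ω)) = convolution (fun _ => (1 : ℝ)) (fun z => f (-z))
      (ContinuousLinearMap.mul ℝ ℝ) (κ ω) := by
    funext x
    rw [hκ, integral_map (measurable_sub_const x).aemeasurable hf.aestronglyMeasurable]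
    simp [convolution]
  rw [h1]
  exact HasCompactSupport.continuous_convolution_right _
    (hfc.comp_homeomorph (Homeomorph.neg (Eucl d)))
    (locallyIntegrable_const _) (hf.comp continuous_neg)

lemma tendsto_integral_thickenedIndicator {μ : Measure (Eucl d)} [IsLocallyFiniteMeasure μ]
    {K : Set (Eucl d)} (hK : IsCompact K) :
    Tendsto (fun n : ℕ => ∫ y, (thickenedIndicator (Nat.one_div_pos_of_nat (n := n)) K y : ℝ) ∂μ)
      atTop (nhds (μ.real K)) := by
  rw [← integral_indicator_one hK.measurableSet]
  have hC : IsCompact (Metric.cthickening 1 K) := hK.cthickening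
  refine tendsto_integral_of_dominated_convergence ((Metric.cthickening 1 K).indicator 1)
    (fun n => ?_) ?_ (fun n => ae_of_all _ fun y => ?_) (ae_of_all _ fun y => ?_)
  · exact (NNReal.continuous_coe.comp (thickenedIndicator _ K).continuous).aestronglyMeasurable
  · exact (integrable_indicator_iff hC.measurableSet).2 (integrableOn_const hC.measure_lt_top.ne)
  · rw [NNReal.norm_eq]
    by_cases hy : y ∈ Metric.cthickening 1 K
    · rw [indicator_of_mem hy]
      exact_mod_cast thickenedIndicator_le_one _ K y
    · rw [thickenedIndicator_zero _ K fun h => hy ?_]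
      · exact_mod_cast indicator_nonneg (fun _ _ => zero_le_one) y
      · refine Metric.thickening_subset_cthickening _ _ (Metric.thickening_mono ?_ K h)
        rw [div_le_one (by positivity)]
        linarith [n.cast_nonneg (α := ℝ)]
  · have h1 := thickenedIndicator_tendsto_indicator_closure
      (fun n : ℕ => Nat.one_div_pos_of_nat (n := n)) (tendsto_one_div_add_atTop_nhds_zero_nat (𝕜 := ℝ)) K
    have h2 := (NNReal.continuous_coe.tendsto _).comp ((tendsto_pi_nhds.1 h1) y)
    rw [hK.isClosed.closure_eq] at h2
    by_cases hy : y ∈ K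
    · simpa [hy, Function.comp_def] using h2
    · simpa [hy, Function.comp_def] using h2

lemma comap_le_approximableSigma [IsFiniteMeasure ν] {κ : Kernel Ω (Eucl d)}
    [∀ ω, IsLocallyFiniteMeasure (κ ω)] (hκ : Equivariant θ κ) :
    MeasurableSpace.comap κ inferInstance ≤ approximableSigma θ ν := by
  refine Measurable.comap_le (@measurable_of_measurable_isCompact Ω (approximableSigma θ ν) d κ _
    fun K hK => ?_)
  have hreal : Measurable[approximableSigma θ ν] fun ω => (κ ω).real K := by
    refine @measurable_of_tendsto_metrizable Ω ℝ (approximableSigma θ ν) _ _ _ _ _ _ (fun n => ?_)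
      (tendsto_pi_nhds.2 fun ω => tendsto_integral_thickenedIndicator (μ := κ ω) hK)
    have hc : Continuous fun y => (thickenedIndicator (Nat.one_div_pos_of_nat (α := ℝ) (n := n)) K y : ℝ) :=
      NNReal.continuous_coe.comp (thickenedIndicator _ K).continuous
    refine measurable_approximableSigma
      (StronglyMeasurable.integral_kernel hc.stronglyMeasurable).measurable
      (orbitContinuous_integral hκ hc (HasCompactSupport.intro (K := Metric.cthickening 1 K) hK.cthickening
        fun y hy => ?_))
    rw [thickenedIndicator_zero _ K fun h => hy ?_]
    · rfl
    · refine Metric.thickening_subset_cthickening _ _ (Metric.thickening_mono ?_ K h)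
      rw [div_le_one (by positivity)]
      linarith [n.cast_nonneg (α := ℝ)]
  have : (fun ω => κ ω K) = fun ω => ENNReal.ofReal ((κ ω).real K) := by
    funext ω
    rw [ofReal_measureReal hK.measure_lt_top.ne]
  rw [this]
  exact ENNReal.measurable_ofReal.comp hreal

/-- The inequality between integrals of functions that are continuous along orbits passes to
indicators of measurable sets. -/
lemma measure_inter_preimage_le {κ κ' : Kernel Ω (Eucl d)} [∀ ω, IsLocallyFiniteMeasure (κ ω)]
    [∀ ω, IsLocallyFiniteMeasure (κ' ω)] (hκ : Equivariant θ κ) (hκ' : Equivariant θ κ')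
    (hσ : ‹MeasurableSpace Ω› ≤ sigmaGen κ κ') {μ ν : Measure Ω} [IsFiniteMeasure μ]
    [IsFiniteMeasure ν] {S : Ω → Ω} (hS : Measurable S)
    (h : ∀ H : Ω → ℝ, Measurable H → OrbitContinuous θ H → (∀ ω, H ω ∈ Icc (0 : ℝ) 1) →
      ∫⁻ ω, ENNReal.ofReal (min (H ω) (H (S ω))) ∂μ ≤ ∫⁻ ω, ENNReal.ofReal (H ω) ∂ν)
    {B : Set Ω} (hB : MeasurableSet B) : μ (B ∩ S ⁻¹' B) ≤ ν B := by
  have happ : OrbitApproximable θ (μ + μ.map S + ν) B :=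
    (hσ.trans (sup_le (comap_le_approximableSigma (ν := μ + μ.map S + ν) hκ)
      (comap_le_approximableSigma hκ'))) B hB
  refine ENNReal.le_of_forall_pos_le_add fun ε hε _ => ?_
  obtain ⟨H, hm, hc, h01, hH⟩ := happ.2 ε (by simpa using hε.ne')
  have hD : Measurable fun ω => ENNReal.ofReal |B.indicator 1 ω - H ω| :=
    ((measurable_one.indicator hB).sub hm).abs.ennreal_ofReal
  rw [lintegral_add_measure, lintegral_add_measure, lintegral_map hD hS] at hH
  have hHle : ∫⁻ ω, ENNReal.ofReal (H ω) ∂ν ≤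
      ν B + ∫⁻ ω, ENNReal.ofReal |B.indicator 1 ω - H ω| ∂ν := by
    rw [← lintegral_indicator_one hB, ← lintegral_add_left (measurable_one.indicator hB)]
    refine lintegral_mono fun ω => ?_
    by_cases hω : ω ∈ B
    · rw [indicator_of_mem hω]
      exact le_add_right (ENNReal.ofReal_le_one.2 (h01 ω).2)
    · rw [indicator_of_notMem hω, indicator_of_notMem hω, zero_sub, abs_neg, zero_add]
      exact ENNReal.ofReal_le_ofReal (le_abs_self _)
  calc μ (B ∩ S ⁻¹' B) = ∫⁻ ω, (B ∩ S ⁻¹' B).indicator 1 ω ∂μ :=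
        (lintegral_indicator_one (hB.inter (hS hB))).symm
    _ ≤ ∫⁻ ω, (ENNReal.ofReal (min (H ω) (H (S ω))) +
          (ENNReal.ofReal |B.indicator 1 ω - H ω| +
            ENNReal.ofReal |B.indicator 1 (S ω) - H (S ω)|)) ∂μ := by
        refine lintegral_mono fun ω => ?_
        by_cases hω : ω ∈ B ∩ S ⁻¹' B
        · have h2 : S ω ∈ B := hω.2
          rw [indicator_of_mem hω, indicator_of_mem hω.1, indicator_of_mem h2, Pi.one_apply,
            Pi.one_apply, ← ENNReal.ofReal_add (abs_nonneg _) (abs_nonneg _),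
            ← ENNReal.ofReal_add (le_min (h01 _).1 (h01 _).1)
              (add_nonneg (abs_nonneg _) (abs_nonneg _)), ← ENNReal.ofReal_one]
          refine ENNReal.ofReal_le_ofReal ?_
          have h3 := le_abs_self (1 - H ω)
          have h4 := le_abs_self (1 - H (S ω))
          have h5 := abs_nonneg (1 - H ω)
          have h6 := abs_nonneg (1 - H (S ω))
          rcases min_choice (H ω) (H (S ω)) with h7 | h7 <;> rw [h7] <;> simp only [Pi.one_apply] <;> linarith
        · rw [indicator_of_notMem hω]
          exact bot_le
    _ = ∫⁻ ω, ENNReal.ofReal (min (H ω) (H (S ω))) ∂μ +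
          (∫⁻ ω, ENNReal.ofReal |B.indicator 1 ω - H ω| ∂μ +
            ∫⁻ ω, ENNReal.ofReal |B.indicator 1 (S ω) - H (S ω)| ∂μ) := by
        rw [lintegral_add_left (f := fun ω => ENNReal.ofReal (min (H ω) (H (S ω))))
          (hm.min (hm.comp hS)).ennreal_ofReal, lintegral_add_left hD]
    _ ≤ ν B + ∫⁻ ω, ENNReal.ofReal |B.indicator 1 ω - H ω| ∂ν +
          (∫⁻ ω, ENNReal.ofReal |B.indicator 1 ω - H ω| ∂μ +
            ∫⁻ ω, ENNReal.ofReal |B.indicator 1 (S ω) - H (S ω)| ∂μ) :=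
        add_le_add_left ((h H hm hc h01).trans hHle) _
    _ ≤ ν B + ε := by
        rw [add_assoc, add_comm (∫⁻ ω, ENNReal.ofReal |B.indicator 1 ω - H ω| ∂ν)]
        exact add_le_add_right hH _

end Approximation

section Contact

variable {d : ℕ} {θ : Eucl d → Ω → Ω} {Φ Ψ : Ω → ℝ}

lemma Admissible.ae_contactSet_subsingleton (hd : 1 ≤ d) (hadm : Admissible θ Φ Ψ) (hθ : IsFlow θ)
    (ω : Ω) {m : Measure (Eucl d)} (hm : DoesNotChargeSmallSets d m) :
    ∀ᵐ x ∂m, (contactSet θ Φ Ψ (θ x ω)).Subsingleton := by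
  have h : ∀ x y, Real.exp (-‖y - x‖) ≤ Φ (θ x ω) + Ψ (θ y ω) := fun x y => by
    have := hadm.le_add (θ x ω) (y - x)
    rwa [hθ.add, add_sub_cancel] at this
  refine measure_mono_null (fun x hx => ?_) (measure_multiple_contact_eq_zero hd h hm)
  by_contra hx'
  refine hx fun v ⟨hv0, hv⟩ w ⟨hw0, hw⟩ => ?_
  by_contra hvw
  rw [hθ.add] at hv hw
  exact hx' ⟨x + v, x + w, by simpa using hvw, by simpa using hv0, by simpa using hw0,
    by simpa using hv, by simpa using hw⟩

end Contact

section Core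

open ProbabilityTheory (Kernel IsSFiniteKernel)

variable {d : ℕ} {θ : Eucl d → Ω → Ω} {P : Measure Ω} {κ κ' : Kernel Ω (Eucl d)}

lemma measurableSet_ae_orbit [IsSFiniteKernel κ] (hθ : IsFlow θ) {U : Set Ω} (hU : MeasurableSet U) :
    MeasurableSet {ω | ∀ᵐ x ∂κ ω, θ x ω ∈ U} :=
  (Kernel.measurable_kernel_prodMk_left (κ := κ) (hθ.measurable_swap hU.compl))
    (measurableSet_singleton 0)

lemma Equivariant.ae_orbit_iff (hκ : Equivariant θ κ) (hθ : IsFlow θ) {U : Set Ω}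
    (hU : MeasurableSet U) (ω : Ω) (y : Eucl d) :
    (∀ᵐ x ∂κ (θ y ω), θ x (θ y ω) ∈ U) ↔ ∀ᵐ x ∂κ ω, θ x ω ∈ U := by
  have hm : MeasurableSet {x | θ x (θ y ω) ∈ U} :=
    hU.preimage (hθ.measurable_uncurry.comp (measurable_id.prodMk measurable_const))
  rw [hκ, ae_map_iff (measurable_sub_const y).aemeasurable hm]
  simp only [hθ.add, add_sub_cancel]

lemma Admissible.pos_dichotomy [IsSFiniteKernel κ] [IsSFiniteKernel κ'] [IsProbabilityMeasure P]
    (hadm : Admissible θ Φ Ψ) (hθ : IsFlow θ) (hκ : Equivariant θ κ)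
    (herg : ∀ A : Set Ω, MeasurableSet A → (∀ x : Eucl d, θ x ⁻¹' A = A) → P A = 0 ∨ P A = 1) :
    (∀ᵐ ω ∂palm P θ κ, 0 < Φ ω) ∨ ∀ᵐ ω ∂palm P θ κ', 0 < Ψ ω := by
  have hU : MeasurableSet {ω | 0 < Φ ω} := measurableSet_lt measurable_const hadm.measurable_left
  have hV : MeasurableSet {ω | 0 < Ψ ω} := measurableSet_lt measurable_const hadm.measurable_right
  have hA := measurableSet_ae_orbit (κ := κ) hθ hU
  rcases herg _ hA fun x => by ext ω; exact hκ.ae_orbit_iff hθ hU ω x with h0 | h1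
  · right
    refine ae_palm_of_ae_ae hθ hV ?_
    filter_upwards [measure_eq_zero_iff_ae_notMem.1 h0] with ω hω
    obtain ⟨x, hx⟩ : ∃ x, ¬ 0 < Φ (θ x ω) := by
      by_contra! h
      exact hω (ae_of_all _ h)
    refine ae_of_all _ fun y => ?_
    have := hadm.le_add (θ x ω) (y - x)
    rw [hθ.add, add_sub_cancel] at this
    have h3 := Real.exp_pos (-‖y - x‖)
    exact (by linarith : 0 < Ψ (θ y ω))
  · left
    exact ae_palm_of_ae_ae hθ hU ((prob_compl_eq_zero_iff hA).2 h1)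

lemma ae_eventually_measure_closedBall_lt {m m' : Measure (Eucl d)} [IsLocallyFiniteMeasure m]
    [IsLocallyFiniteMeasure m'] (h : m'.MutuallySingular m) :
    ∀ᵐ x ∂m, ∀ᶠ n : ℕ in atTop,
      m' (Metric.closedBall x (1 / (n + 1))) < m (Metric.closedBall x (1 / (n + 1))) := by
  have hr : Tendsto (fun n : ℕ => (1 : ℝ) / (n + 1)) atTop (nhdsWithin 0 (Ioi 0)) :=
    tendsto_nhdsWithin_iff.2 ⟨tendsto_one_div_add_atTop_nhds_zero_nat,
      .of_forall fun n => mem_Ioi.2 Nat.one_div_pos_of_nat⟩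
  filter_upwards [Besicovitch.ae_tendsto_rnDeriv m' m, Besicovitch.ae_tendsto_rnDeriv m m,
    h.rnDeriv_ae_eq_zero, m.rnDeriv_self] with x h1 h2 h3 h4
  rw [h3] at h1
  rw [h4] at h2
  filter_upwards [(h1.comp hr).eventually_lt_const (zero_lt_one : (0 : ENNReal) < 1),
    (h2.comp hr).eventually_const_lt (zero_lt_one : (0 : ENNReal) < 1)] with n h5 h6
  have h7 : m (Metric.closedBall x (1 / (n + 1))) ≠ 0 := fun h => by
    simp [-one_div, h] at h6
  simp only [Function.comp_def] at h5
  rwa [ENNReal.div_lt_iff (Or.inl h7) (Or.inl (isCompact_closedBall _ _).measure_lt_top.ne),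
    one_mul] at h5

/-- The points around which `κ'` is eventually smaller than `κ`. -/
def dominatedSet (κ κ' : Kernel Ω (Eucl d)) : Set Ω :=
  {ω | ∀ᶠ n : ℕ in atTop,
    κ' ω (Metric.closedBall 0 (1 / (n + 1))) < κ ω (Metric.closedBall 0 (1 / (n + 1)))}

lemma measurableSet_dominatedSet : MeasurableSet (dominatedSet κ κ') := by
  have : dominatedSet κ κ' = ⋃ N : ℕ, ⋂ n ≥ N, {ω | κ' ω (Metric.closedBall 0 (1 / (n + 1))) <
      κ ω (Metric.closedBall 0 (1 / (n + 1)))} := by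
    ext ω
    simp only [dominatedSet, mem_ofPred_eq, eventually_atTop, mem_iUnion, mem_iInter]
  rw [this]
  exact MeasurableSet.iUnion fun _ => MeasurableSet.iInter fun _ => MeasurableSet.iInter fun _ =>
    measurableSet_lt (κ'.measurable_coe Metric.isClosed_closedBall.measurableSet)
      (κ.measurable_coe Metric.isClosed_closedBall.measurableSet)

lemma mem_dominatedSet_iff (hκ : Equivariant θ κ) (hκ' : Equivariant θ κ') (ω : Ω) (x : Eucl d) :
    θ x ω ∈ dominatedSet κ κ' ↔ ∀ᶠ n : ℕ in atTop,
      κ' ω (Metric.closedBall x (1 / (n + 1))) < κ ω (Metric.closedBall x (1 / (n + 1))) := by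
  have h : ∀ r : ℝ, (fun y => y - x) ⁻¹' Metric.closedBall 0 r = Metric.closedBall x r := fun r => by
    ext y
    simp [dist_eq_norm]
  simp only [dominatedSet, mem_ofPred_eq, hκ ω x, hκ' ω x,
    Measure.map_apply (measurable_sub_const x) Metric.isClosed_closedBall.measurableSet, h]

/-- A map under which mass does not increase on any measurable set, up to the intersection with
that set, transports mutually singular measures of the same mass into each other. -/
lemma map_eq_of_measure_inter_preimage_le {μ ν : Measure Ω} [IsFiniteMeasure μ]
    (hmass : μ univ = ν univ) {S : Ω → Ω} (hS : Measurable S)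
    (hle : ∀ B, MeasurableSet B → μ (B ∩ S ⁻¹' B) ≤ ν B) {A : Set Ω} (hA : MeasurableSet A)
    (hμA : μ Aᶜ = 0) (hνA : ν A = 0) : μ.map S = ν := by
  refine Measure.eq_of_le_of_measure_univ_eq (Measure.le_iff.2 fun B hB => ?_) ?_
  · rw [Measure.map_apply hS hB]
    calc μ (S ⁻¹' B) ≤ μ (((A ∪ B) ∩ S ⁻¹' (A ∪ B)) ∪ Aᶜ) := measure_mono fun ω hω => by
          by_cases h : ω ∈ A
          · exact Or.inl ⟨Or.inl h, Or.inr hω⟩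
          · exact Or.inr h
      _ ≤ μ ((A ∪ B) ∩ S ⁻¹' (A ∪ B)) + μ Aᶜ := measure_union_le _ _
      _ ≤ ν A + ν B := by
          rw [hμA, add_zero]
          exact (hle _ (hA.union hB)).trans (measure_union_le _ _)
      _ = ν B := by rw [hνA, zero_add]
  · rw [Measure.map_apply hS MeasurableSet.univ, preimage_univ, hmass]

lemma exists_countable_piSystem (E : Type*) [TopologicalSpace E] [SecondCountableTopology E]
    [MeasurableSpace E] [BorelSpace E] : ∃ C : Set (Set E), C.Countable ∧ IsPiSystem C ∧
      ‹MeasurableSpace E› = MeasurableSpace.generateFrom C := by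
  obtain ⟨b, hbc, -, hb⟩ := TopologicalSpace.exists_countable_basis E
  refine ⟨sInter '' {t | t.Finite ∧ t ⊆ b}, (countable_ofPred_finite_subset hbc).image _, ?_, ?_⟩
  · rintro _ ⟨s, ⟨hs, hsb⟩, rfl⟩ _ ⟨t, ⟨ht, htb⟩, rfl⟩ -
    exact ⟨s ∪ t, ⟨hs.union ht, union_subset hsb htb⟩, sInter_union s t⟩
  · refine le_antisymm ?_ (MeasurableSpace.generateFrom_le ?_)
    · rw [BorelSpace.measurable_eq (α := E), hb.borel_eq_generateFrom]
      exact MeasurableSpace.generateFrom_mono fun s hs =>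
        ⟨{s}, ⟨finite_singleton s, singleton_subset_iff.2 hs⟩, sInter_singleton s⟩
    · rintro _ ⟨s, ⟨hs, hsb⟩, rfl⟩
      exact (hs.isOpen_sInter fun t ht => hb.isOpen (hsb ht)).measurableSet

/-- If a shift of the origin transports one Palm measure to another, then the associated
allocation balances the random measures. -/
lemma ae_map_eq_of_map_palm_eq [IsProbabilityMeasure P] [IsSFiniteKernel κ] [IsSFiniteKernel κ']
    [∀ ω, IsLocallyFiniteMeasure (κ' ω)] (hθ : IsFlow θ)
    (hstat : ∀ x, MeasurePreserving (θ x) P P) (hκ : Equivariant θ κ) (hκ' : Equivariant θ κ')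
    {τ : Ω → Eucl d} (hτ : Measurable τ)
    (hmap : (palm P θ κ).map (fun ω => θ (τ ω) ω) = palm P θ κ') :
    ∀ᵐ ω ∂P, (κ ω).map (fun x => x + τ (θ x ω)) = κ' ω := by
  have hT : Measurable fun p : Ω × Eucl d => p.2 + τ (θ p.2 p.1) :=
    measurable_snd.add (hτ.comp hθ.measurable_swap)
  have hTω : ∀ ω, Measurable fun x => x + τ (θ x ω) := fun ω =>
    hT.comp (measurable_const.prodMk measurable_id)
  have hS : Measurable fun ω => θ (τ ω) ω := hθ.measurable_uncurry.comp (hτ.prodMk measurable_id)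
  have key : ∀ F : Ω → Eucl d → ENNReal, Measurable (Function.uncurry F) →
      ∫⁻ ω, ∫⁻ x, F ω (x + τ (θ x ω)) ∂κ ω ∂P = ∫⁻ ω, ∫⁻ x, F ω x ∂κ' ω ∂P := fun F hF => by
    have hG : Measurable fun ω => ∫⁻ z : Eucl d, F (θ (-z) ω) z :=
      Measurable.lintegral_prod_right' (f := fun q : Ω × Eucl d => F (θ (-q.2) q.1) q.2)
        (hF.comp ((hθ.measurable_swap.comp (measurable_fst.prodMk measurable_snd.neg)).prodMk
          measurable_snd))
    rw [← lintegral_palm_lintegral hθ hstat hκ' hF, ← hmap, lintegral_map hG hS,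
      ← lintegral_palm_lintegral hθ hstat hκ (F := fun ω x => F ω (x + τ (θ x ω)))
        (hF.comp (measurable_fst.prodMk hT))]
    refine lintegral_congr fun ω => ?_
    rw [← lintegral_sub_right_eq_self _ (τ ω)]
    refine lintegral_congr fun w => ?_
    rw [hθ.add, hθ.add, neg_add_cancel, hθ.zero, sub_add_cancel]
    congr 2
    abel
  have hB : ∀ B : Set (Eucl d), MeasurableSet B →
      ∀ᵐ ω ∂P, (κ ω).map (fun x => x + τ (θ x ω)) B = κ' ω B := fun B hB => by
    have hm : Measurable fun ω => (κ ω).map (fun x => x + τ (θ x ω)) B := by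
      simp only [fun ω => Measure.map_apply (μ := κ ω) (hTω ω) hB]
      exact Kernel.measurable_kernel_prodMk_left (κ := κ) (hT hB)
    refine ae_eq_of_forall_setLIntegral_eq_of_sigmaFinite hm (κ'.measurable_coe hB)
      fun C hC _ => ?_
    have hF : Measurable (Function.uncurry fun (ω : Ω) (x : Eucl d) =>
        (C ×ˢ B).indicator (1 : Ω × Eucl d → ENNReal) (ω, x)) :=
      measurable_one.indicator (hC.prod hB)
    have hprod : ∀ {ω}, ω ∈ C → ∀ y, (C ×ˢ B).indicator (1 : Ω × Eucl d → ENNReal) (ω, y) =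
        B.indicator 1 y := fun {ω} hω y => by
      by_cases hy : y ∈ B
      · rw [indicator_of_mem hy, indicator_of_mem (mk_mem_prod hω hy)]
        rfl
      · rw [indicator_of_notMem hy, indicator_of_notMem fun h => hy h.2]
    rw [← lintegral_indicator hC, ← lintegral_indicator hC]
    convert key _ hF using 2
    · funext ω
      by_cases hω : ω ∈ C
      · rw [indicator_of_mem hω, ← lintegral_indicator_one hB,
          lintegral_map (measurable_one.indicator hB) (hTω ω)]
        exact lintegral_congr fun x => (hprod hω _).symm
      · simp [hω]
    · funext ω
      by_cases hω : ω ∈ C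
      · rw [indicator_of_mem hω, ← lintegral_indicator_one hB]
        exact lintegral_congr fun x => (hprod hω _).symm
      · simp [hω]
  obtain ⟨C, hCc, hCpi, hCgen⟩ := exists_countable_piSystem (Eucl d)
  have hCm : ∀ s ∈ C, MeasurableSet s := fun s hs =>
    hCgen ▸ MeasurableSpace.measurableSet_generateFrom hs
  have h1 : ∀ᵐ ω ∂P, ∀ s ∈ C, ∀ n : ℕ, (κ ω).map (fun x => x + τ (θ x ω))
      (s ∩ Metric.closedBall 0 n) = κ' ω (s ∩ Metric.closedBall 0 n) :=
    (ae_ball_iff hCc).2 fun s hs => ae_all_iff.2 fun n =>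
      hB _ ((hCm s hs).inter Metric.isClosed_closedBall.measurableSet)
  have h2 : ∀ᵐ ω ∂P, ∀ n : ℕ, (κ ω).map (fun x => x + τ (θ x ω))
      (Metric.closedBall 0 n) = κ' ω (Metric.closedBall 0 n) :=
    ae_all_iff.2 fun n => hB _ Metric.isClosed_closedBall.measurableSet
  filter_upwards [h1, h2] with ω h1 h2
  refine (Measure.ext_of_generateFrom_of_cover (T := range fun n : ℕ => Metric.closedBall 0 n)
    hCgen (countable_range _) hCpi ?_ ?_ ?_ ?_)
  · rw [sUnion_range, Metric.iUnion_closedBall_nat]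
  · rintro _ ⟨n, rfl⟩
    rw [h2]
    exact (isCompact_closedBall _ _).measure_lt_top.ne
  · rintro _ ⟨n, rfl⟩ s hs
    exact h1 s hs n
  · rintro _ ⟨n, rfl⟩
    exact h2 n

/-- The balancing statement for random measures that are locally finite everywhere and generate
the σ-algebra of the underlying space. -/
theorem exists_shift_map_eq [IsProbabilityMeasure P] [IsSFiniteKernel κ] [IsSFiniteKernel κ']
    [∀ ω, IsLocallyFiniteMeasure (κ ω)] [∀ ω, IsLocallyFiniteMeasure (κ' ω)] (hd : 1 ≤ d)
    (hθ : IsFlow θ) (hstat : ∀ x, MeasurePreserving (θ x) P P)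
    (herg : ∀ A : Set Ω, MeasurableSet A → (∀ x : Eucl d, θ x ⁻¹' A = A) → P A = 0 ∨ P A = 1)
    (hκ : Equivariant θ κ) (hκ' : Equivariant θ κ') (hσ : ‹MeasurableSpace Ω› ≤ sigmaGen κ κ')
    (hfin : ∫⁻ ω, κ ω (unitCube d) ∂P < ⊤)
    (hint : ∫⁻ ω, κ ω (unitCube d) ∂P = ∫⁻ ω, κ' ω (unitCube d) ∂P)
    (hae : ∀ B, MeasurableSet B → (∀ ω, (κ ω).MutuallySingular (κ' ω) →
      DoesNotChargeSmallSets d (κ ω) → ω ∈ B) → ∀ᵐ ω ∂P, ω ∈ B) :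
    ∃ τ : Ω → Eucl d, Measurable τ ∧ ∀ᵐ ω ∂P, (κ ω).map (fun x => x + τ (θ x ω)) = κ' ω := by
  have hmass : palm P θ κ univ = palm P θ κ' univ := by rw [palm_univ hθ, palm_univ hθ, hint]
  have : IsFiniteMeasure (palm P θ κ) := ⟨by rwa [palm_univ hθ]⟩
  have : IsFiniteMeasure (palm P θ κ') := ⟨by rwa [palm_univ hθ, ← hint]⟩
  have hpalm : ∀ {κ₁ : Kernel Ω (Eucl d)} [IsSFiniteKernel κ₁] {U : Set Ω}, MeasurableSet U →
      (∀ ω, (κ ω).MutuallySingular (κ' ω) → DoesNotChargeSmallSets d (κ ω) →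
        ∀ᵐ x ∂κ₁ ω, θ x ω ∈ U) → ∀ᵐ ω ∂palm P θ κ₁, ω ∈ U := fun hU h =>
    ae_palm_of_ae_ae hθ hU (hae _ (measurableSet_ae_orbit hθ hU) h)
  obtain ⟨Φ, Ψ, hadm, hmin⟩ := exists_admissible_dualCost_le hθ (palm P θ κ) (palm P θ κ')
  obtain ⟨hU, τ, hτ, hsel⟩ := exists_measurable_eq_of_subsingleton (0 : Eucl d)
    (N := contactSet θ Φ Ψ) (fun ω h => h.1 rfl)
    fun K hK h0 => hadm.measurableSet_contactSet_inter hθ hK h0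
  have hcontact : ∀ᵐ ω ∂palm P θ κ, ∀ v, Φ ω + Ψ (θ v ω) = Real.exp (-‖v‖) → v = 0 ∨ v = τ ω := by
    filter_upwards [hpalm (κ₁ := κ) hU fun ω _ h => hadm.ae_contactSet_subsingleton hd hθ ω h]
      with ω hω v hv
    by_cases h0 : v = 0
    · exact Or.inl h0
    · exact Or.inr (hsel ω hω v ⟨h0, hv⟩)
  have hS : Measurable fun ω => θ (τ ω) ω := hθ.measurable_uncurry.comp (hτ.prodMk measurable_id)
  refine ⟨τ, hτ, ae_map_eq_of_map_palm_eq hθ hstat hκ hκ' hτ ?_⟩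
  refine map_eq_of_measure_inter_preimage_le hmass hS (fun B hB => ?_)
    (measurableSet_dominatedSet (κ := κ) (κ' := κ')) ?_ ?_
  · exact measure_inter_preimage_le hκ hκ' hσ hS (fun H hHm hH hH01 =>
      hadm.lintegral_min_le hmass hθ hmin hHm hH hH01 hcontact
        (hadm.pos_dichotomy hθ hκ herg)) hB
  · refine hpalm measurableSet_dominatedSet fun ω h _ => ?_
    filter_upwards [ae_eventually_measure_closedBall_lt h.symm] with x hx
    exact (mem_dominatedSet_iff hκ hκ' ω x).2 hx
  · refine measure_eq_zero_iff_ae_notMem.2 (hpalm measurableSet_dominatedSet.compl fun ω h _ => ?_)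
    filter_upwards [ae_eventually_measure_closedBall_lt h] with x hx hx'
    obtain ⟨n, h1, h2⟩ := (hx.and ((mem_dominatedSet_iff hκ hκ' ω x).1 hx')).exists
    exact lt_asymm h1 h2

end Core

section Reduction

open ProbabilityTheory (Kernel IsSFiniteKernel IsFiniteKernel)

variable {d : ℕ} {θ : Eucl d → Ω → Ω}

open Classical in
lemma isSFiniteKernel_of_isLocallyFiniteMeasure {κ : Kernel Ω (Eucl d)}
    [∀ ω, IsLocallyFiniteMeasure (κ ω)] : IsSFiniteKernel κ := by
  obtain ⟨A, hA⟩ : ∃ A : ℕ → Set (Eucl d), A = disjointed fun n : ℕ => Metric.closedBall 0 n :=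
    ⟨_, rfl⟩
  have hAm : ∀ n, MeasurableSet (A n) := fun n => by
    rw [hA]
    exact MeasurableSet.disjointed (fun n => Metric.isClosed_closedBall.measurableSet) n
  have hAd : Pairwise (Function.onFun Disjoint A) := hA ▸ disjoint_disjointed _
  have hAU : ⋃ n, A n = univ := by
    rw [hA, iUnion_disjointed, Metric.iUnion_closedBall_nat]
  have hAfin : ∀ n ω, κ ω (A n) ≠ ⊤ := fun n ω => by
    refine ((measure_mono ?_).trans_lt
      (isCompact_closedBall (0 : Eucl d) (n : ℝ)).measure_lt_top).ne
    rw [hA]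
    exact disjointed_subset _ n
  have hL : ∀ p : ℕ × ℕ, MeasurableSet {ω | ⌊(κ ω (A p.1)).toReal⌋₊ = p.2} := fun p =>
    (Nat.measurable_floor.comp (κ.measurable_coe (hAm p.1)).ennreal_toReal)
      (measurableSet_singleton p.2)
  have hfin : ∀ p : ℕ × ℕ, IsFiniteKernel (Kernel.piecewise (hL p) (κ.restrict (hAm p.1)) 0) :=
    fun p => ⟨⟨ENNReal.ofReal (p.2 + 1), ENNReal.ofReal_lt_top, fun ω => by
      rw [Kernel.piecewise_apply]
      split_ifs with h
      · rw [Kernel.restrict_apply' _ _ _ MeasurableSet.univ, univ_inter]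
        refine ENNReal.le_ofReal_iff_toReal_le (hAfin _ _) (by positivity) |>.2 ?_
        have h' : ⌊(κ ω (A p.1)).toReal⌋₊ = p.2 := h
        rw [← h']
        exact (Nat.lt_floor_add_one _).le
      · simp⟩⟩
  have : κ = Kernel.sum fun p : ℕ × ℕ => Kernel.piecewise (hL p) (κ.restrict (hAm p.1)) 0 := by
    ext ω s hs
    rw [Kernel.sum_apply' _ _ hs]
    have h1 : ∀ p : ℕ × ℕ, (Kernel.piecewise (hL p) (κ.restrict (hAm p.1)) 0) ω s =
        if p.2 = ⌊(κ ω (A p.1)).toReal⌋₊ then κ ω (s ∩ A p.1) else 0 := fun p => by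
      rw [Kernel.piecewise_apply]
      simp only [mem_ofPred_eq, eq_comm (a := p.2)]
      split_ifs with h
      · rw [Kernel.restrict_apply' _ _ _ hs]
      · simp
    rw [tsum_congr h1, ENNReal.tsum_prod (f := fun n k : ℕ =>
      if k = ⌊(κ ω (A n)).toReal⌋₊ then κ ω (s ∩ A n) else 0)]
    simp only [tsum_ite_eq]
    rw [← measure_iUnion (fun i j hij => (hAd hij).mono inter_subset_right inter_subset_right)
      fun n => hs.inter (hAm n), ← inter_iUnion, hAU, inter_univ]
  rw [this]
  infer_instance

lemma exists_shift_map_eq_of_le_sigmaGen (hd : 1 ≤ d) {P : Measure Ω} [IsProbabilityMeasure P]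
    (hθ0 : ∀ ω, θ 0 ω = ω) (hθadd : ∀ (x y : Eucl d) (ω : Ω), θ y (θ x ω) = θ (x + y) ω)
    {ξ η : Ω → Measure (Eucl d)} (hξm : Measurable ξ) (hηm : Measurable η)
    (hσ : ‹MeasurableSpace Ω› ≤ sigmaGen ξ η)
    (hstat : ∀ x B, MeasurableSet B → P (θ x ⁻¹' B) = P B)
    (herg : ∀ A : Set Ω, MeasurableSet A → (∀ x : Eucl d, θ x ⁻¹' A = A) → P A = 0 ∨ P A = 1)
    (hξloc : ∀ ω, IsLocallyFiniteMeasure (ξ ω)) (hηloc : ∀ ω, IsLocallyFiniteMeasure (η ω))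
    (hξeq : ∀ (ω : Ω) (x : Eucl d), ξ (θ x ω) = (ξ ω).map fun y => y - x)
    (hηeq : ∀ (ω : Ω) (x : Eucl d), η (θ x ω) = (η ω).map fun y => y - x)
    (hfin : ∫⁻ ω, ξ ω (unitCube d) ∂P < ⊤)
    (hint : ∫⁻ ω, ξ ω (unitCube d) ∂P = ∫⁻ ω, η ω (unitCube d) ∂P)
    (hae : ∀ B, MeasurableSet B → (∀ ω, (ξ ω).MutuallySingular (η ω) →
      DoesNotChargeSmallSets d (ξ ω) → ω ∈ B) → ∀ᵐ ω ∂P, ω ∈ B) :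
    ∃ τ : Ω → Eucl d, (Measurable fun p : Ω × Eucl d => p.2 + τ (θ p.2 p.1)) ∧
      ∀ᵐ ω ∂P, (ξ ω).map (fun x => x + τ (θ x ω)) = η ω := by
  have hmeas : ∀ {ζ : Ω → Measure (Eucl d)}, Measurable ζ → (∀ ω, IsLocallyFiniteMeasure (ζ ω)) →
      (∀ ω x, ζ (θ x ω) = (ζ ω).map fun y => y - x) →
      Measurable (ζ ∘ fun p : Eucl d × Ω => θ p.1 p.2) := fun {ζ} hm hloc heq => by
    have : ∀ ω, IsLocallyFiniteMeasure ((⟨ζ, hm⟩ : Kernel Ω (Eucl d)) ω) := hloc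
    have := isSFiniteKernel_of_isLocallyFiniteMeasure (κ := ⟨ζ, hm⟩)
    refine Measure.measurable_of_measurable_coe _ fun s hs => ?_
    simp only [Function.comp_apply, heq, Measure.map_apply (measurable_sub_const _) hs]
    exact Kernel.measurable_kernel_prodMk_left
      (κ := (⟨ζ, hm⟩ : Kernel Ω (Eucl d)).comap (Prod.snd : Eucl d × Ω → Ω) measurable_snd)
      (t := {q : (Eucl d × Ω) × Eucl d | q.2 - q.1.1 ∈ s})
      (hs.preimage (measurable_snd.sub (measurable_fst.comp measurable_fst)))
  have hθm : Measurable[_, sigmaGen ξ η] fun p : Eucl d × Ω => θ p.1 p.2 := by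
    rw [measurable_iff_comap_le, sigmaGen, MeasurableSpace.comap_sup, MeasurableSpace.comap_comp,
      MeasurableSpace.comap_comp]
    exact sup_le (hmeas hξm hξloc hξeq).comap_le (hmeas hηm hηloc hηeq).comap_le
  have hθ : IsFlow θ := ⟨hθm.mono le_rfl hσ, hθ0, hθadd⟩
  have hlocκ : ∀ ω, IsLocallyFiniteMeasure ((⟨ξ, hξm⟩ : Kernel Ω (Eucl d)) ω) := hξloc
  have hlocκ' : ∀ ω, IsLocallyFiniteMeasure ((⟨η, hηm⟩ : Kernel Ω (Eucl d)) ω) := hηloc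
  have := isSFiniteKernel_of_isLocallyFiniteMeasure (κ := ⟨ξ, hξm⟩)
  have := isSFiniteKernel_of_isLocallyFiniteMeasure (κ := ⟨η, hηm⟩)
  obtain ⟨τ, hτ, h⟩ := exists_shift_map_eq (κ := ⟨ξ, hξm⟩) (κ' := ⟨η, hηm⟩) hd hθ
    (fun x => ⟨hθ.measurable x, Measure.ext fun B hB => by
      rw [Measure.map_apply (hθ.measurable x) hB, hstat x B hB]⟩)
    herg hξeq hηeq hσ hfin hint hae
  exact ⟨τ, measurable_snd.add (hτ.comp hθ.measurable_swap), h⟩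

/-- The event that both measures are finite on bounded sets. -/
def locallyFiniteSet (ξ η : Ω → Measure (Eucl d)) : Set Ω :=
  {ω | ∀ n : ℕ, ξ ω (Metric.closedBall 0 n) < ⊤ ∧ η ω (Metric.closedBall 0 n) < ⊤}

lemma measurableSet_locallyFiniteSet {ξ η : Ω → Measure (Eucl d)} (hξ : Measurable ξ)
    (hη : Measurable η) : MeasurableSet (locallyFiniteSet ξ η) := by
  have : locallyFiniteSet ξ η = ⋂ n : ℕ, {ω | ξ ω (Metric.closedBall 0 n) < ⊤} ∩
      {ω | η ω (Metric.closedBall 0 n) < ⊤} := by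
    ext ω
    simp [locallyFiniteSet]
  rw [this]
  exact MeasurableSet.iInter fun n =>
    (measurableSet_lt ((Measure.measurable_coe Metric.isClosed_closedBall.measurableSet).comp hξ)
      measurable_const).inter
    (measurableSet_lt ((Measure.measurable_coe Metric.isClosed_closedBall.measurableSet).comp hη)
      measurable_const)

lemma isLocallyFiniteMeasure_of_closedBall_nat {m : Measure (Eucl d)}
    (h : ∀ n : ℕ, m (Metric.closedBall 0 n) < ⊤) : IsLocallyFiniteMeasure m := by
  refine ⟨fun x => ?_⟩
  obtain ⟨n, hn⟩ := exists_nat_gt ‖x‖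
  exact ⟨Metric.closedBall 0 n, Metric.closedBall_mem_nhds_of_mem (by simpa using hn), h n⟩

lemma mem_locallyFiniteSet_of_mem {ξ η : Ω → Measure (Eucl d)}
    (hξeq : ∀ (ω : Ω) (x : Eucl d), ξ (θ x ω) = (ξ ω).map fun y => y - x)
    (hηeq : ∀ (ω : Ω) (x : Eucl d), η (θ x ω) = (η ω).map fun y => y - x) {ω : Ω}
    (h : ω ∈ locallyFiniteSet ξ η) (x : Eucl d) : θ x ω ∈ locallyFiniteSet ξ η := by
  intro n
  have h1 := isLocallyFiniteMeasure_of_closedBall_nat fun n => (h n).1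
  have h2 := isLocallyFiniteMeasure_of_closedBall_nat fun n => (h n).2
  have h3 : (fun y => y - x) ⁻¹' Metric.closedBall 0 (n : ℝ) = Metric.closedBall x n := by
    ext y
    simp [dist_eq_norm]
  rw [hξeq, hηeq, Measure.map_apply (measurable_sub_const x) Metric.isClosed_closedBall.measurableSet,
    Measure.map_apply (measurable_sub_const x) Metric.isClosed_closedBall.measurableSet, h3]
  exact ⟨(isCompact_closedBall _ _).measure_lt_top, (isCompact_closedBall _ _).measure_lt_top⟩

lemma mem_locallyFiniteSet_iff (hθ0 : ∀ ω, θ 0 ω = ω)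
    (hθadd : ∀ (x y : Eucl d) (ω : Ω), θ y (θ x ω) = θ (x + y) ω) {ξ η : Ω → Measure (Eucl d)}
    (hξeq : ∀ (ω : Ω) (x : Eucl d), ξ (θ x ω) = (ξ ω).map fun y => y - x)
    (hηeq : ∀ (ω : Ω) (x : Eucl d), η (θ x ω) = (η ω).map fun y => y - x) (ω : Ω) (x : Eucl d) :
    θ x ω ∈ locallyFiniteSet ξ η ↔ ω ∈ locallyFiniteSet ξ η := by
  refine ⟨fun h => ?_, fun h => mem_locallyFiniteSet_of_mem hξeq hηeq h x⟩
  have := mem_locallyFiniteSet_of_mem hξeq hηeq h (-x)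
  rwa [hθadd, add_neg_cancel, hθ0] at this

end Reduction

/-- **Corollary (mutually singular case).** If additionally `ξ` and `η` are a.s. mutually
singular and `ξ` a.s. does not charge small sets, then there exists a factor allocation. -/
theorem factor_allocation_of_mutually_singular
    {d : ℕ} (hd : 1 ≤ d)
    (ℙ : Measure Ω) [IsProbabilityMeasure ℙ]
    (θ : Eucl d → Ω → Ω)
    (hθmeas : Measurable fun p : Eucl d × Ω => θ p.1 p.2)
    (hθ0 : ∀ ω, θ 0 ω = ω)
    (hθadd : ∀ (x y : Eucl d) (ω : Ω), θ y (θ x ω) = θ (x + y) ω)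
    (hstat : ∀ x : Eucl d, MeasurePreserving (θ x) ℙ ℙ)
    (herg : ∀ A : Set Ω, MeasurableSet A → (∀ x : Eucl d, θ x ⁻¹' A = A) →
      ℙ A = 0 ∨ ℙ A = 1)
    (ξ η : Ω → Measure (Eucl d))
    (hξm : ∀ B : Set (Eucl d), MeasurableSet B → Measurable fun ω => ξ ω B)
    (hηm : ∀ B : Set (Eucl d), MeasurableSet B → Measurable fun ω => η ω B)
    (hξloc : ∀ᵐ ω ∂ℙ, ∀ K : Set (Eucl d), IsCompact K → ξ ω K < ⊤)
    (hηloc : ∀ᵐ ω ∂ℙ, ∀ K : Set (Eucl d), IsCompact K → η ω K < ⊤)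
    (hξeq : ∀ (ω : Ω) (x : Eucl d), ξ (θ x ω) = Measure.map (fun y => y - x) (ξ ω))
    (hηeq : ∀ (ω : Ω) (x : Eucl d), η (θ x ω) = Measure.map (fun y => y - x) (η ω))
    (hfin : ∫⁻ ω, ξ ω (unitCube d) ∂ℙ < ⊤)
    (hint : ∫⁻ ω, ξ ω (unitCube d) ∂ℙ = ∫⁻ ω, η ω (unitCube d) ∂ℙ)
    (hsing : ∀ᵐ ω ∂ℙ, Measure.MutuallySingular (ξ ω) (η ω))
    (hsmall : ∀ᵐ ω ∂ℙ, DoesNotChargeSmallSets d (ξ ω)) :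
    ∃ T : Ω → Eucl d → Eucl d,
      IsFactorAllocation θ ξ η T ∧
      ∀ᵐ ω ∂ℙ, Measure.map (T ω) (ξ ω) = η ω := by
  classical
  have hξm' : Measurable ξ := Measure.measurable_of_measurable_coe _ hξm
  have hηm' : Measurable η := Measure.measurable_of_measurable_coe _ hηm
  have hle : sigmaGen ξ η ≤ ‹MeasurableSpace Ω› := sup_le hξm'.comap_le hηm'.comap_le
  have hξg : Measurable[sigmaGen ξ η] ξ := measurable_iff_comap_le.2 le_sup_left
  have hηg : Measurable[sigmaGen ξ η] η := measurable_iff_comap_le.2 le_sup_right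
  set S := locallyFiniteSet ξ η
  have hSm : MeasurableSet[sigmaGen ξ η] S := @measurableSet_locallyFiniteSet Ω (sigmaGen ξ η) d ξ η hξg hηg
  have hSae : ∀ᵐ ω ∂ℙ, ω ∈ S := by
    filter_upwards [hξloc, hηloc] with ω h1 h2 n
    exact ⟨h1 _ (isCompact_closedBall _ _), h2 _ (isCompact_closedBall _ _)⟩
  let ξ' : Ω → Measure (Eucl d) := fun ω => if ω ∈ S then ξ ω else 0
  let η' : Ω → Measure (Eucl d) := fun ω => if ω ∈ S then η ω else 0
  have hξ' : ∀ ω ∈ S, ξ' ω = ξ ω := fun ω h => if_pos h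
  have hη' : ∀ ω ∈ S, η' ω = η ω := fun ω h => if_pos h
  have hle' : sigmaGen ξ' η' ≤ sigmaGen ξ η :=
    sup_le (Measurable.comap_le (hξg.ite hSm measurable_const))
      (Measurable.comap_le (hηg.ite hSm measurable_const))
  have hle'' := hle'.trans hle
  have hprob : @IsProbabilityMeasure Ω (sigmaGen ξ' η') (ℙ.trim hle'') :=
    @IsProbabilityMeasure.mk Ω (sigmaGen ξ' η') _
      (by rw [trim_measurableSet_eq _ MeasurableSet.univ, measure_univ])
  have hξ'm : Measurable[sigmaGen ξ' η'] ξ' := measurable_iff_comap_le.2 le_sup_left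
  have hη'm : Measurable[sigmaGen ξ' η'] η' := measurable_iff_comap_le.2 le_sup_right
  have hcube : MeasurableSet (unitCube d) := measurableSet_unitCube d
  have hiξ : @lintegral Ω (sigmaGen ξ' η') (ℙ.trim hle'') (fun ω => ξ' ω (unitCube d)) =
      ∫⁻ ω, ξ ω (unitCube d) ∂ℙ := by
    refine (lintegral_trim hle'' ((Measure.measurable_coe hcube).comp hξ'm)).trans ?_
    exact lintegral_congr_ae (hSae.mono fun ω h => by simp only [Function.comp_apply, hξ' ω h])
  have hiη : @lintegral Ω (sigmaGen ξ' η') (ℙ.trim hle'') (fun ω => η' ω (unitCube d)) =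
      ∫⁻ ω, η ω (unitCube d) ∂ℙ := by
    refine (lintegral_trim hle'' ((Measure.measurable_coe hcube).comp hη'm)).trans ?_
    exact lintegral_congr_ae (hSae.mono fun ω h => by simp only [Function.comp_apply, hη' ω h])
  have hmem := mem_locallyFiniteSet_iff hθ0 hθadd hξeq hηeq
  have hξ'eq : ∀ ω x, ξ' (θ x ω) = (ξ' ω).map fun y => y - x := fun ω x => by
    by_cases h : ω ∈ S
    · rw [hξ' ω h, hξ' _ ((hmem ω x).2 h), hξeq]
    · have h' : θ x ω ∉ S := mt (hmem ω x).1 h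
      simp only [ξ', if_neg h, if_neg h', Measure.map_zero]
  have hη'eq : ∀ ω x, η' (θ x ω) = (η' ω).map fun y => y - x := fun ω x => by
    by_cases h : ω ∈ S
    · rw [hη' ω h, hη' _ ((hmem ω x).2 h), hηeq]
    · have h' : θ x ω ∉ S := mt (hmem ω x).1 h
      simp only [η', if_neg h, if_neg h', Measure.map_zero]
  have hθ' : ∀ x, Measurable[sigmaGen ξ' η', sigmaGen ξ' η'] (θ x) := fun x => by
    rw [measurable_iff_comap_le]
    nth_rw 1 [sigmaGen]
    rw [MeasurableSpace.comap_sup, MeasurableSpace.comap_comp, MeasurableSpace.comap_comp]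
    refine sup_le (Measurable.comap_le ?_) (Measurable.comap_le ?_)
    · rw [show ξ' ∘ θ x = _ from funext fun ω => hξ'eq ω x]
      exact (Measure.measurable_map _ (measurable_sub_const x)).comp hξ'm
    · rw [show η' ∘ θ x = _ from funext fun ω => hη'eq ω x]
      exact (Measure.measurable_map _ (measurable_sub_const x)).comp hη'm
  obtain ⟨τ, hτ, hτae⟩ := @exists_shift_map_eq_of_le_sigmaGen Ω (sigmaGen ξ' η') d θ hd
    (ℙ.trim hle'') hprob hθ0 hθadd ξ' η' hξ'm hη'm le_rfl
    (fun x B hB => by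
      rw [trim_measurableSet_eq hle'' hB, trim_measurableSet_eq hle'' (hθ' x hB),
        (hstat x).measure_preimage (hle'' _ hB).nullMeasurableSet])
    (fun A hA hinv => by
      rw [trim_measurableSet_eq hle'' hA]
      exact herg A (hle'' _ hA) hinv)
    (fun ω => by
      by_cases h : ω ∈ S
      · rw [hξ' ω h]
        exact isLocallyFiniteMeasure_of_closedBall_nat fun n => (h n).1
      · simp only [ξ', if_neg h]
        infer_instance)
    (fun ω => by
      by_cases h : ω ∈ S
      · rw [hη' ω h]
        exact isLocallyFiniteMeasure_of_closedBall_nat fun n => (h n).2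
      · simp only [η', if_neg h]
        infer_instance)
    hξ'eq hη'eq
    (by rwa [hiξ]) (by rw [hiξ, hiη, hint])
    (fun B hB h => by
      have hB' : ∀ᵐ ω ∂ℙ, ω ∈ B := by
        filter_upwards [hSae, hsing, hsmall] with ω h1 h2 h3
        exact h ω (by rwa [hξ' ω h1, hη' ω h1]) (by rwa [hξ' ω h1])
      rw [ae_iff] at hB' ⊢
      exact (trim_measurableSet_eq hle'' hB.compl).trans hB')
  have hprod : ∀ {m m' : MeasurableSpace Ω}, m ≤ m' →
      m.prod (inferInstance : MeasurableSpace (Eucl d)) ≤ m'.prod inferInstance :=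
    fun h => sup_le_sup (MeasurableSpace.comap_mono h) le_rfl
  refine ⟨fun ω x => x + τ (θ x ω), ⟨hτ.mono (hprod hle'') le_rfl, fun ω x y => ?_,
    hτ.mono (hprod hle') le_rfl⟩, ?_⟩
  · simp only [hθadd, add_comm x y]
    abel
  · filter_upwards [hSae, ae_of_ae_trim hle'' hτae] with ω h1 h2
    rwa [hξ' ω h1, hη' ω h1] at h2
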